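/- arXiv:1201.1777 — 2 statements merged into one kernel-verified Lean document; each statement's English description precedes it below -/
import Mathlib

section
/- There exist constants c₁ > 0 and q₀ such that for every integer q ≥ q₀ the following holds: the function ∏_{χ mod q} L(s,χ) (the product of all Dirichlet L-functions modulo q) has at most one zero s = σ + it with σ ≥ 1 − c₁/log(q(2 + |t|)). Moreover, if such a zero exists, it is real, it is a simple zero (its analytic order as a zero equals 1), and it is a zero of L(s,χ) for a nonprincipal real Dirichlet character χ mod q. -/
open scoped Classical

/-- The product of all Dirichlet L-functions modulo `q`, as a function of `s`. -/
noncomputable def LProd (q : ℕ) [NeZero q] (s : ℂ) : ℂ :=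
  ∏ χ : DirichletCharacter ℂ q, χ.LFunction s

/-- The analytic order of `f` at `z` (as an element of `ℕ∞`), defined to be `0` when `f` is not
analytic at `z`. -/
noncomputable def analyticZeroOrder (f : ℂ → ℂ) (z : ℂ) : ℕ∞ :=
  if h : AnalyticAt ℂ f z then analyticOrderAt f z else 0

/-- A Dirichlet character is real if all its values are fixed by complex conjugation. -/
def DirichletCharacter.IsReal {q : ℕ} (χ : DirichletCharacter ℂ q) : Prop :=
  ∀ a : ZMod q, χ a = (starRingEnd ℂ) (χ a)

/-! ### Landau's bound for the logarithmic derivative -/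

open Complex Metric in
/-- A zero-free holomorphic function on a disc has a holomorphic logarithm, normalised to vanish
at the centre. -/
lemma exists_log_of_ne_zero_on_ball {h : ℂ → ℂ} {r : ℝ} (hr : 0 < r)
    (hd : DifferentiableOn ℂ h (ball 0 r)) (h0 : ∀ z ∈ ball (0 : ℂ) r, h z ≠ 0) :
    ∃ k : ℂ → ℂ, k 0 = 0 ∧ (∀ z ∈ ball (0 : ℂ) r, HasDerivAt k (deriv h z / h z) z) ∧
      ∀ z ∈ ball (0 : ℂ) r, h z = h 0 * exp (k z) := by
  have hd' : DifferentiableOn ℂ (fun z => deriv h z / h z) (ball 0 r) :=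
    (hd.deriv isOpen_ball).div hd h0
  obtain ⟨k, hk⟩ := hd'.isExactOn_ball
  refine ⟨fun z => k z - k 0, by simp, fun z hz => (hk z hz).sub_const _, ?_⟩
  have hderiv : ∀ z ∈ ball (0 : ℂ) r,
      HasDerivAt (fun z => h z * exp (-(k z - k 0))) 0 z := by
    intro z hz
    have h1 : HasDerivAt h (deriv h z) z :=
        (hd.differentiableAt (isOpen_ball.mem_nhds hz)).hasDerivAt
    have h2 := h1.mul (((hk z hz).sub_const (k 0)).neg.cexp)
    convert! h2 using 1
    field_simp [h0 z hz]
    ring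
  intro z hz
  have hc := (isOpen_ball (x := (0 : ℂ)) (ε := r)).is_const_of_deriv_eq_zero
    (convex_ball (0 : ℂ) r).isPreconnected
    (fun z hz => (hderiv z hz).differentiableAt.differentiableWithinAt)
    (fun z hz => (hderiv z hz).deriv) hz (mem_ball_self hr)
  simp only [sub_self, neg_zero, exp_zero, mul_one] at hc
  rw [← hc, mul_assoc, ← exp_add]
  simp

open Complex Metric in
lemma norm_logDeriv_le_of_ne_zero {h : ℂ → ℂ} {r M : ℝ} (hr : 0 < r) (hM : 0 < M)
    (hd : DifferentiableOn ℂ h (ball 0 r)) (h0 : ∀ z ∈ ball (0 : ℂ) r, h z ≠ 0)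
    (hb : ∀ z ∈ ball (0 : ℂ) r, ‖h z‖ ≤ ‖h 0‖ * Real.exp M) :
    ‖logDeriv h 0‖ ≤ 4 * M / r := by
  obtain ⟨k, hk0, hk, hexp⟩ := exists_log_of_ne_zero_on_ball hr hd h0
  have hre : Set.MapsTo k (ball 0 r) {z | z.re ≤ M} := by
    intro z hz
    have h1 := hb z hz
    rw [hexp z hz, norm_mul, norm_exp] at h1
    have h2 : 0 < ‖h 0‖ := norm_pos_iff.2 (h0 0 (mem_ball_self hr))
    exact Real.exp_le_exp.1 (le_of_mul_le_mul_left h1 h2)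
  have hkd : DifferentiableOn ℂ k (ball 0 r) := fun z hz =>
    (hk z hz).differentiableAt.differentiableWithinAt
  have hsub : closedBall (0 : ℂ) (r / 2) ⊆ ball 0 r := closedBall_subset_ball (by linarith)
  have hdc : DiffContOnCl ℂ k (ball 0 (r / 2)) := by
    apply DifferentiableOn.diffContOnCl
    rw [closure_ball _ (by positivity)]
    exact hkd.mono hsub
  have hbound : ∀ z ∈ sphere (0 : ℂ) (r / 2), ‖k z‖ ≤ 2 * M := by
    intro z hz
    have h1 := borelCaratheodory_zero hM hkd hre hr (hsub (sphere_subset_closedBall hz)) hk0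
    rw [mem_sphere_zero_iff_norm] at hz
    rw [hz] at h1
    refine h1.trans_eq ?_
    field_simp
    ring
  have h3 := norm_deriv_le_of_forall_mem_sphere_norm_le (by positivity) hdc hbound
  rw [(hk 0 (mem_ball_self hr)).deriv] at h3
  rw [logDeriv_apply]
  refine h3.trans_eq ?_
  field_simp
  ring

lemma logDeriv_multiset_prod {u : ℂ → ℂ → ℂ} {z : ℂ} (Z : Multiset ℂ)
    (hu : ∀ ρ ∈ Z, u ρ z ≠ 0) (hd : ∀ ρ ∈ Z, Differentiable ℂ (u ρ)) :
    Differentiable ℂ (fun w => (Z.map fun ρ => u ρ w).prod) ∧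
      (Z.map fun ρ => u ρ z).prod ≠ 0 ∧
      logDeriv (fun w => (Z.map fun ρ => u ρ w).prod) z =
        (Z.map fun ρ => logDeriv (u ρ) z).sum := by
  induction Z using Multiset.induction_on with
  | empty => simp [logDeriv_apply]
  | cons a Z ih =>
    obtain ⟨h1, h2, h3⟩ := ih (fun ρ h => hu ρ (Multiset.mem_cons_of_mem h))
      (fun ρ h => hd ρ (Multiset.mem_cons_of_mem h))
    have ha := hu a (Multiset.mem_cons_self _ _)
    have ha' := hd a (Multiset.mem_cons_self _ _)
    simp only [Multiset.map_cons, Multiset.prod_cons, Multiset.sum_cons]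
    refine ⟨ha'.mul h1, mul_ne_zero ha h2, ?_⟩
    rw [logDeriv_mul z ha h2 (ha' z) (h1 z), h3]

open Complex Metric ComplexConjugate in
lemma norm_blaschke {R : ℝ} (hR : 0 < R) (ρ : ℂ) {z : ℂ} (hz : ‖z‖ = R) :
    ‖(R : ℂ) - conj ρ * z / R‖ = ‖z - ρ‖ := by
  have hzz : conj z * z = R * R := by
    rw [← normSq_eq_conj_mul_self, normSq_eq_norm_sq, hz]; push_cast; ring
  have hR' : (R : ℂ) ≠ 0 := by exact_mod_cast hR.ne'
  have h1 : (R : ℂ) - conj ρ * z / R = conj (z - ρ) * z / R := by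
    rw [map_sub, sub_mul, hzz]
    field_simp
  rw [h1, norm_div, norm_mul, RCLike.norm_conj, hz, norm_real, Real.norm_eq_abs, abs_of_pos hR]
  field_simp

open Complex Metric ComplexConjugate in
/-- Replacing the factors `z - ρ` by `R - conj ρ * z / R` does not increase the maximum on the
disc of radius `R`. -/
lemma norm_mul_blaschke_le {f g : ℂ → ℂ} {R A : ℝ} (hR : 0 < R) (hg : Differentiable ℂ g)
    (Z : Multiset ℂ) (hf : ∀ z, f z = (Z.map fun ρ => z - ρ).prod * g z)
    (hA : ∀ z ∈ closedBall (0 : ℂ) R, ‖f z‖ ≤ A) {z : ℂ} (hz : z ∈ closedBall (0 : ℂ) R) :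
    ‖(Z.map fun ρ => (R : ℂ) - conj ρ * z / R).prod * g z‖ ≤ A := by
  have hQ : ∀ Z : Multiset ℂ,
      Differentiable ℂ (fun w => (Z.map fun ρ => (R : ℂ) - conj ρ * w / R).prod) := by
    intro Z
    induction Z using Multiset.induction_on with
    | empty => simp
    | cons a Z ih =>
      simp only [Multiset.map_cons, Multiset.prod_cons]
      exact Differentiable.mul (by fun_prop) ih
  refine norm_le_of_forall_mem_frontier_norm_le (U := ball (0 : ℂ) R)
    (f := fun z => (Z.map fun ρ => (R : ℂ) - conj ρ * z / R).prod * g z) isBounded_ball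
    (((hQ Z).mul hg).diffContOnCl) ?_ (by rwa [closure_ball _ hR.ne'])
  intro w hw
  rw [frontier_ball _ hR.ne'] at hw
  have hw' := mem_sphere_zero_iff_norm.1 hw
  have h1 := hA w (sphere_subset_closedBall hw)
  rw [hf w, norm_mul] at h1
  rw [norm_mul]
  convert! h1 using 2
  clear hf h1
  induction Z using Multiset.induction_on with
  | empty => simp
  | cons a Z ih => simp only [Multiset.map_cons, Multiset.prod_cons, norm_mul, ih,
      norm_blaschke hR a hw']

open Complex Metric ComplexConjugate in
lemma pow_card_le_of_factor {f g : ℂ → ℂ} {r R A : ℝ} (hr : 0 < r) (hR : 0 < R)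
    (hg : Differentiable ℂ g) (Z : Multiset ℂ) (hZ : ∀ ρ ∈ Z, ρ ∈ ball (0 : ℂ) r)
    (hf : ∀ z, f z = (Z.map fun ρ => z - ρ).prod * g z)
    (hA : ∀ z ∈ closedBall (0 : ℂ) R, ‖f z‖ ≤ A) :
    (R / r) ^ Multiset.card Z * ‖f 0‖ ≤ A := by
  have h1 := norm_mul_blaschke_le hR hg Z hf hA (mem_closedBall_self hR.le)
  simp only [mul_zero, zero_div, sub_zero, Multiset.map_const', Multiset.prod_replicate, norm_mul,
    norm_pow, norm_real, Real.norm_eq_abs, abs_of_pos hR] at h1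
  refine le_trans ?_ h1
  have h2 : ‖(Z.map fun ρ => (0 : ℂ) - ρ).prod‖ ≤ r ^ Multiset.card Z := by
    clear hf h1
    induction Z using Multiset.induction_on with
    | empty => simp
    | cons a Z ih =>
      simp only [Multiset.map_cons, Multiset.prod_cons, norm_mul, Multiset.card_cons, pow_succ']
      have ha := hZ a (Multiset.mem_cons_self _ _)
      gcongr
      · simpa using (mem_ball_zero_iff.1 ha).le
      · exact ih (fun ρ h => hZ ρ (Multiset.mem_cons_of_mem h))
  rw [hf 0, norm_mul, div_pow]
  calc _ ≤ R ^ Multiset.card Z / r ^ Multiset.card Z * (r ^ Multiset.card Z * ‖g 0‖) := by gcongr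
    _ = _ := by field_simp

open Complex Metric ComplexConjugate in
/-- All zeros of an entire function in a disc can be split off, starting from a prescribed
multiset of zeros. -/
lemma exists_factor_ne_zero {f g₀ : ℂ → ℂ} {r : ℝ} (hr : 0 < r) (hf : Differentiable ℂ f)
    (hf0 : f 0 ≠ 0) (hg₀ : Differentiable ℂ g₀) (S : Multiset ℂ) (hS : ∀ ρ ∈ S, ρ ∈ ball (0 : ℂ) r)
    (hfS : ∀ z, f z = (S.map fun ρ => z - ρ).prod * g₀ z) :
    ∃ (Z : Multiset ℂ) (g : ℂ → ℂ), (∀ ρ ∈ S + Z, ρ ∈ ball (0 : ℂ) r) ∧ Differentiable ℂ g ∧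
      (∀ z, f z = ((S + Z).map fun ρ => z - ρ).prod * g z) ∧ ∀ z ∈ ball (0 : ℂ) r, g z ≠ 0 := by
  obtain ⟨A, hA⟩ := (isCompact_closedBall (0 : ℂ) (2 * r)).exists_bound_of_continuousOn
    hf.continuous.continuousOn
  let P : ℕ → Prop := fun n => ∃ (Z : Multiset ℂ) (g : ℂ → ℂ), Multiset.card Z = n ∧
    (∀ ρ ∈ S + Z, ρ ∈ ball (0 : ℂ) r) ∧ Differentiable ℂ g ∧
      (∀ z, f z = ((S + Z).map fun ρ => z - ρ).prod * g z)
  have hP0 : P 0 := ⟨0, g₀, rfl, by simpa using hS, hg₀, by simpa using hfS⟩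
  obtain ⟨N, hN⟩ := pow_unbounded_of_one_lt (A / ‖f 0‖) (one_lt_two (α := ℝ))
  have hbdd : ∀ n, P n → n ≤ N := by
    rintro n ⟨Z, g, hn, hZ, hg, hfac⟩
    have h1 := pow_card_le_of_factor hr (by positivity : 0 < 2 * r) hg (S + Z) hZ hfac hA
    rw [show 2 * r / r = 2 by field_simp] at h1
    have h2 : (2 : ℝ) ^ Multiset.card (S + Z) ≤ A / ‖f 0‖ :=
      (le_div_iff₀ (norm_pos_iff.2 hf0)).2 h1
    have h3 : Multiset.card (S + Z) < N := (pow_lt_pow_iff_right₀ one_lt_two).1 (h2.trans_lt hN)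
    rw [Multiset.card_add] at h3
    omega
  have hmem : sSup {n | P n} ∈ {n | P n} := Nat.sSup_mem ⟨0, hP0⟩ ⟨N, hbdd⟩
  obtain ⟨Z, g, hn, hZ, hg, hfac⟩ := hmem
  refine ⟨Z, g, hZ, hg, hfac, fun ρ hρ hgρ => ?_⟩
  have hP : P (sSup {n | P n} + 1) := by
    refine ⟨ρ ::ₘ Z, dslope g ρ, by simp [hn], ?_, ?_, fun z => ?_⟩
    · intro w hw
      rw [Multiset.add_cons, Multiset.mem_cons] at hw
      rcases hw with rfl | hw
      · exact hρ
      · exact hZ w hw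
    · rw [← differentiableOn_univ, differentiableOn_dslope Filter.univ_mem]
      exact hg.differentiableOn
    · have h1 := sub_smul_dslope g ρ z
      rw [hgρ, sub_zero, smul_eq_mul] at h1
      rw [hfac z, Multiset.add_cons, Multiset.map_cons, Multiset.prod_cons, ← h1]
      ring
  exact Nat.not_succ_le_self _ (le_csSup (s := {n | P n}) ⟨N, hbdd⟩ hP)

lemma re_inv_sub_conj_nonpos {ρ : ℂ} {R : ℝ} (h0 : 0 < ‖ρ‖) (hR : ‖ρ‖ ≤ R) (hre : ρ.re ≤ 0) :
    (1 / ρ - (starRingEnd ℂ) ρ / R ^ 2).re ≤ 0 := by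
  have h1 : (1 / ρ - (starRingEnd ℂ) ρ / R ^ 2).re = ρ.re * (1 / ‖ρ‖ ^ 2 - 1 / R ^ 2) := by
    rw [Complex.sub_re, one_div, Complex.inv_re, Complex.normSq_eq_norm_sq, ← Complex.ofReal_pow,
      Complex.div_ofReal_re, Complex.conj_re]
    ring
  rw [h1]
  refine mul_nonpos_of_nonpos_of_nonneg hre (sub_nonneg.2 ?_)
  gcongr

open Complex Metric ComplexConjugate in
/-- **Landau's lemma** at the centre of a disc, with real part bounded above by the contribution
of finitely many zeros. -/
lemma re_neg_logDeriv_le {f g₀ : ℂ → ℂ} {r M : ℝ} (hr : 0 < r) (hM : 0 < M)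
    (hf : Differentiable ℂ f) (hf0 : f 0 ≠ 0)
    (hb : ∀ z ∈ closedBall (0 : ℂ) (2 * r), ‖f z‖ ≤ ‖f 0‖ * Real.exp M)
    (hre : ∀ z ∈ ball (0 : ℂ) r, f z = 0 → z.re ≤ 0)
    (hg₀ : Differentiable ℂ g₀) (S : Multiset ℂ) (hS : ∀ ρ ∈ S, ρ ∈ ball (0 : ℂ) r)
    (hfS : ∀ z, f z = (S.map fun ρ => z - ρ).prod * g₀ z) :
    (-logDeriv f 0).re ≤ 4 * M / r + (S.map fun ρ => (1 / ρ).re + 1 / r).sum := by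
  obtain ⟨Z, g, hZ, hg, hfac, hgne⟩ := exists_factor_ne_zero hr hf hf0 hg₀ S hS hfS
  set T := S + Z with hT
  have hR : 0 < 2 * r := by positivity
  have hR' : (r : ℂ) ≠ 0 := by exact_mod_cast hr.ne'
  have hzero : ∀ ρ ∈ T, f ρ = 0 := by
    intro ρ hρ
    rw [hfac ρ, Multiset.prod_eq_zero, zero_mul]
    exact Multiset.mem_map.2 ⟨ρ, hρ, sub_self ρ⟩
  have hne : ∀ ρ ∈ T, ρ ≠ 0 := fun ρ hρ h => hf0 (h ▸ hzero ρ hρ)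
  have hQne : ∀ z ∈ ball (0 : ℂ) r, ∀ ρ ∈ T, ((2 * r : ℝ) : ℂ) - conj ρ * z / (2 * r : ℝ) ≠ 0 := by
    intro z hz ρ hρ h
    have h1 : ‖((2 * r : ℝ) : ℂ)‖ = ‖conj ρ * z / (2 * r : ℝ)‖ :=
      congrArg norm (sub_eq_zero.1 h)
    rw [norm_div, norm_mul, RCLike.norm_conj, norm_real, Real.norm_eq_abs, abs_of_pos hR] at h1
    have h2 := mem_ball_zero_iff.1 (hZ ρ hρ)
    have h3 := mem_ball_zero_iff.1 hz
    rw [eq_div_iff hR.ne'] at h1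
    nlinarith [norm_nonneg ρ, norm_nonneg z]
  obtain ⟨hPd, hPne, hPl⟩ := logDeriv_multiset_prod (u := fun ρ z => z - ρ) (z := 0) T
    (fun ρ hρ => by simpa using hne ρ hρ) (fun ρ _ => by fun_prop)
  obtain ⟨hQd, hQ0, hQl⟩ := logDeriv_multiset_prod
    (u := fun ρ z => ((2 * r : ℝ) : ℂ) - conj ρ * z / (2 * r : ℝ)) (z := 0) T
    (fun ρ hρ => hQne 0 (mem_ball_self hr) ρ hρ) (fun ρ _ => by fun_prop)
  set h : ℂ → ℂ := fun z =>
    (T.map fun ρ => ((2 * r : ℝ) : ℂ) - conj ρ * z / (2 * r : ℝ)).prod * g z with hh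
  have hhd : Differentiable ℂ h := hQd.mul hg
  have hg0 := hgne 0 (mem_ball_self hr)
  have hh0 : ‖f 0‖ ≤ ‖h 0‖ := by
    simp only [hh]
    rw [hfac 0, norm_mul, norm_mul]
    gcongr
    clear_value T
    clear hPd hPne hPl hQd hQ0 hQl hQne hfac hzero hne hT hh hhd h
    induction T using Multiset.induction_on with
    | empty => simp
    | cons a Z ih =>
      simp only [Multiset.map_cons, Multiset.prod_cons, norm_mul]
      have ha := mem_ball_zero_iff.1 (hZ a (Multiset.mem_cons_self _ _))
      gcongr ?_ * ?_
      · rw [mul_zero, zero_div, sub_zero, zero_sub, norm_neg, norm_real, Real.norm_eq_abs,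
          abs_of_pos hR]
        linarith
      · exact ih (fun ρ h => hZ ρ (Multiset.mem_cons_of_mem h))
  have hhl : ‖logDeriv h 0‖ ≤ 4 * M / r := by
    refine norm_logDeriv_le_of_ne_zero hr hM hhd.differentiableOn (fun z hz => ?_) (fun z hz => ?_)
    · refine mul_ne_zero (Multiset.prod_ne_zero ?_) (hgne z hz)
      intro h0
      obtain ⟨ρ, hρ, h1⟩ := Multiset.mem_map.1 h0
      exact hQne z hz ρ hρ h1
    · refine (norm_mul_blaschke_le hR hg T hfac hb
        (ball_subset_closedBall (ball_subset_ball (by linarith) hz))).trans ?_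
      gcongr
  have hl1 : logDeriv h 0 = _ := logDeriv_mul (0 : ℂ) hQ0 hg0 (hQd 0) (hg 0)
  have hl2 : logDeriv f 0 = (T.map fun ρ => logDeriv (fun z => z - ρ) 0).sum + logDeriv g 0 := by
    rw [← hPl, ← logDeriv_mul (0 : ℂ) hPne hg0 (hPd 0) (hg 0)]
    congr 1
    exact funext hfac
  rw [hQl] at hl1
  have hl3 : -logDeriv f 0 = -logDeriv h 0
      + (T.map fun ρ => 1 / ρ - conj ρ / ((2 * r : ℝ) : ℂ) ^ 2).sum := by
    rw [hl1, hl2]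
    have : (T.map fun ρ => logDeriv (fun z : ℂ => z - ρ) 0).sum
      = (T.map fun ρ => logDeriv (fun z => ((2 * r : ℝ) : ℂ) - conj ρ * z / (2 * r : ℝ)) 0).sum
        - (T.map fun ρ => 1 / ρ - conj ρ / ((2 * r : ℝ) : ℂ) ^ 2).sum := by
      rw [← Multiset.sum_map_sub]
      congr 1
      refine Multiset.map_congr rfl fun ρ hρ => ?_
      have h1 : HasDerivAt (fun z => ((2 * r : ℝ) : ℂ) - conj ρ * z / (2 * r : ℝ))
          (-(conj ρ * 1 / (2 * r : ℝ))) 0 :=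
        (((hasDerivAt_id (0 : ℂ)).const_mul (conj ρ)).div_const _).const_sub _
      have h2 : HasDerivAt (fun z : ℂ => z - ρ) 1 0 := (hasDerivAt_id (0 : ℂ)).sub_const _
      rw [logDeriv_apply, logDeriv_apply, h1.deriv, h2.deriv]
      have := hne ρ hρ
      push_cast
      field_simp
      ring
    rw [this]
    ring
  have hsum : ∀ U : Multiset ℂ, ((U.map fun ρ => 1 / ρ - conj ρ / ((2 * r : ℝ) : ℂ) ^ 2).sum).re
      = (U.map fun ρ => (1 / ρ - conj ρ / ((2 * r : ℝ) : ℂ) ^ 2).re).sum := by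
    intro U
    induction U using Multiset.induction_on with
    | empty => simp
    | cons a U ih => simp only [Multiset.map_cons, Multiset.sum_cons, add_re, ih]
  rw [hl3, add_re, hsum, hT, Multiset.map_add, Multiset.sum_add]
  have h1 : (-logDeriv h 0).re ≤ 4 * M / r :=
    (re_le_norm _).trans (by rwa [norm_neg])
  have h2 : (Z.map fun ρ => (1 / ρ - conj ρ / ((2 * r : ℝ) : ℂ) ^ 2).re).sum ≤ 0 := by
    refine (Multiset.sum_map_le_sum_map _ (fun _ => 0) fun ρ hρ => ?_).trans (by simp)
    have hρT : ρ ∈ T := Multiset.mem_add.2 (Or.inr hρ)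
    have h3 := hZ ρ hρT
    refine re_inv_sub_conj_nonpos (norm_pos_iff.2 (hne ρ hρT)) ?_ (hre ρ h3 (hzero ρ hρT))
    have := mem_ball_zero_iff.1 h3
    linarith
  have h3 : (S.map fun ρ => (1 / ρ - conj ρ / ((2 * r : ℝ) : ℂ) ^ 2).re).sum
      ≤ (S.map fun ρ => (1 / ρ).re + 1 / r).sum := by
    refine Multiset.sum_map_le_sum_map _ _ fun ρ hρ => ?_
    rw [sub_re, sub_eq_add_neg]
    gcongr
    rw [← neg_re]
    refine (re_le_norm _).trans ?_
    have h4 := mem_ball_zero_iff.1 (hS ρ hρ)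
    rw [norm_neg, norm_div, RCLike.norm_conj, norm_pow, norm_real, Real.norm_eq_abs,
      abs_of_pos hR, div_le_div_iff₀ (by positivity) hr]
    nlinarith
  linarith

/-! ### Growth of Dirichlet L-functions to the right of the imaginary axis -/

section Growth

open Complex MeasureTheory Filter Asymptotics

variable {q : ℕ} [NeZero q]

lemma sum_range_character (χ : DirichletCharacter ℂ q) (N : ℕ) :
    ∑ k ∈ Finset.range q, χ ((N + k : ℕ) : ZMod q) = ∑ a : ZMod q, χ a := by
  induction N with
  | zero =>
    refine Finset.sum_nbij (fun k => (k : ZMod q)) (by simp) ?_ ?_ (by simp)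
    · intro a ha b hb hab
      have h1 := (ZMod.natCast_eq_natCast_iff' a b q).1 hab
      rwa [Nat.mod_eq_of_lt (by simpa using ha), Nat.mod_eq_of_lt (by simpa using hb)] at h1
    · intro a _
      exact ⟨a.val, by simpa using ZMod.val_lt a, by simp⟩
  | succ N ih =>
    have h1 := Finset.sum_range_succ (fun k => χ ((N + k : ℕ) : ZMod q)) q
    rw [Finset.sum_range_succ'] at h1
    have h2 : χ ((N + q : ℕ) : ZMod q) = χ ((N + 0 : ℕ) : ZMod q) := by simp
    rw [h2] at h1
    rw [← ih, ← add_right_cancel h1]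
    exact Finset.sum_congr rfl fun k _ => by rw [add_right_comm, add_assoc]

/-- The mean value of a Dirichlet character over a period. -/
noncomputable def characterMean (χ : DirichletCharacter ℂ q) : ℂ := (∑ a : ZMod q, χ a) / q

lemma characterMean_eq_zero {χ : DirichletCharacter ℂ q} (hχ : χ ≠ 1) : characterMean χ = 0 := by
  rw [characterMean, χ.sum_eq_zero_of_ne_one hχ, zero_div]

lemma norm_characterMean_le (χ : DirichletCharacter ℂ q) : ‖characterMean χ‖ ≤ 1 := by
  rw [characterMean, norm_div, div_le_one (by simpa using NeZero.pos q)]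
  refine (norm_sum_le _ _).trans ?_
  refine (Finset.sum_le_sum fun a _ => χ.norm_le_one a).trans ?_
  simp [ZMod.card]

lemma norm_sum_range_sub_le (χ : DirichletCharacter ℂ q) (N : ℕ) :
    ‖∑ k ∈ Finset.range N, χ (k : ZMod q) - N * characterMean χ‖ ≤ 2 * q := by
  have hq : (q : ℂ) ≠ 0 := by exact_mod_cast NeZero.ne q
  induction N using Nat.strong_induction_on with
  | _ N ih =>
    rcases lt_or_ge N q with h | h
    · calc _ ≤ ‖∑ k ∈ Finset.range N, χ (k : ZMod q)‖ + ‖N * characterMean χ‖ := norm_sub_le _ _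
        _ ≤ N + N := by
          gcongr
          · refine (norm_sum_le _ _).trans ?_
            refine (Finset.sum_le_sum fun (a : ℕ) _ => χ.norm_le_one (a : ZMod q)).trans ?_
            simp
          · rw [norm_mul, _root_.norm_natCast]
            exact mul_le_of_le_one_right (Nat.cast_nonneg _) (norm_characterMean_le χ)
        _ ≤ 2 * q := by
          have : (N : ℝ) ≤ q := by exact_mod_cast h.le
          linarith
    · obtain ⟨M, rfl⟩ := Nat.exists_eq_add_of_le' h
      have h1 := ih M (by have := NeZero.pos q; omega)
      rw [Finset.sum_range_add, sum_range_character]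
      convert! h1 using 2
      rw [characterMean]
      push_cast
      field_simp
      ring

/-- The error term in the partial sums of a Dirichlet character. -/
noncomputable def characterError (χ : DirichletCharacter ℂ q) (x : ℝ) : ℂ :=
  ∑ k ∈ Finset.Icc 1 ⌊x⌋₊, χ (k : ZMod q) - x * characterMean χ

lemma norm_characterError_le (χ : DirichletCharacter ℂ q) {x : ℝ} (hx : 0 ≤ x) :
    ‖characterError χ x‖ ≤ 4 * q := by
  have h1 := norm_sum_range_sub_le χ (⌊x⌋₊ + 1)
  have h2 : ∑ k ∈ Finset.range (⌊x⌋₊ + 1), χ (k : ZMod q)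
      = χ 0 + ∑ k ∈ Finset.Icc 1 ⌊x⌋₊, χ (k : ZMod q) := by
    rw [Finset.range_eq_Ico, Finset.sum_eq_sum_Ico_succ_bot (by omega)]
    simp only [Nat.cast_zero, zero_add]
    rfl
  have h3 : characterError χ x = (∑ k ∈ Finset.range (⌊x⌋₊ + 1), χ (k : ZMod q)
      - (⌊x⌋₊ + 1 : ℕ) * characterMean χ) - χ 0
      + ((⌊x⌋₊ + 1 - x : ℝ) : ℂ) * characterMean χ := by
    rw [h2, characterError]
    push_cast
    ring
  have h4 : ‖((⌊x⌋₊ + 1 - x : ℝ) : ℂ) * characterMean χ‖ ≤ 1 := by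
    rw [norm_mul, norm_real, Real.norm_eq_abs]
    have h5 : |(⌊x⌋₊ : ℝ) + 1 - x| ≤ 1 := by
      rw [abs_le]
      constructor <;> linarith [Nat.floor_le hx, Nat.lt_floor_add_one x]
    exact mul_le_one₀ h5 (norm_nonneg _) (norm_characterMean_le χ)
  have h6 : (1 : ℝ) ≤ q := by exact_mod_cast NeZero.pos q
  rw [h3]
  refine (norm_add_le _ _).trans ?_
  refine (add_le_add_left (norm_sub_le _ _) _).trans ?_
  linarith [χ.norm_le_one 0]

lemma measurable_characterError (χ : DirichletCharacter ℂ q) : Measurable (characterError χ) := by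
  unfold characterError
  refine Measurable.sub ?_ (by fun_prop)
  exact (measurable_of_countable (fun n : ℕ => ∑ k ∈ Finset.Icc 1 n, χ (k : ZMod q))).comp
    Nat.measurable_floor

/-- The Mellin-type integral of the error term. -/
noncomputable def characterIntegral (χ : DirichletCharacter ℂ q) (s : ℂ) : ℂ :=
  ∫ t in Set.Ioi (1 : ℝ), characterError χ t * (t : ℂ) ^ (-(s + 1))

lemma norm_characterError_mul_cpow_le (χ : DirichletCharacter ℂ q) (s : ℂ) {t : ℝ}
    (ht : t ∈ Set.Ioi (1 : ℝ)) :
    ‖characterError χ t * (t : ℂ) ^ (-(s + 1))‖ ≤ 4 * q * t ^ (-(s.re + 1)) := by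
  have ht0 : 0 < t := zero_lt_one.trans ht
  rw [norm_mul, norm_cpow_eq_rpow_re_of_pos ht0]
  have := norm_characterError_le χ ht0.le
  simp only [neg_re, add_re, one_re]
  gcongr

lemma integrableOn_characterError (χ : DirichletCharacter ℂ q) {s : ℂ} (hs : 0 < s.re) :
    IntegrableOn (fun t : ℝ => characterError χ t * (t : ℂ) ^ (-(s + 1))) (Set.Ioi 1) := by
  refine Integrable.mono' (g := fun t : ℝ => 4 * q * t ^ (-(s.re + 1)))
    ((integrableOn_Ioi_rpow_of_lt (by linarith) one_pos).const_mul _) ?_ ?_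
  · refine AEStronglyMeasurable.mul (measurable_characterError χ).aestronglyMeasurable ?_
    refine ContinuousOn.aestronglyMeasurable (fun t ht => ?_) measurableSet_Ioi
    have ht0 : 0 < t := zero_lt_one.trans ht
    exact (continuousAt_ofReal_cpow_const t _ (Or.inr ht0.ne')).continuousWithinAt
  · exact (ae_restrict_iff' measurableSet_Ioi).2
      (ae_of_all _ fun t ht => norm_characterError_mul_cpow_le χ s ht)

lemma norm_characterIntegral_le (χ : DirichletCharacter ℂ q) {s : ℂ} (hs : 0 < s.re) :
    ‖characterIntegral χ s‖ ≤ 4 * q / s.re := by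
  have h1 : ∫ t in Set.Ioi (1 : ℝ), 4 * q * t ^ (-(s.re + 1)) = 4 * q / s.re := by
    rw [integral_const_mul, integral_Ioi_rpow_of_lt (by linarith) one_pos]
    simp
    field_simp
  rw [← h1]
  refine norm_integral_le_of_norm_le
    ((integrableOn_Ioi_rpow_of_lt (by linarith) one_pos).const_mul _) ?_
  exact (ae_restrict_iff' measurableSet_Ioi).2
      (ae_of_all _ fun t ht => norm_characterError_mul_cpow_le χ s ht)

lemma differentiableAt_characterIntegral (χ : DirichletCharacter ℂ q) {s : ℂ} (hs : 0 < s.re) :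
    DifferentiableAt ℂ (characterIntegral χ) s := by
  let f : ℝ → ℂ := (Set.Ioi (1 : ℝ)).indicator (characterError χ)
  have hfb : ∀ x, 0 < x → ‖f x‖ ≤ 4 * q := by
    intro x hx
    exact (norm_indicator_le_norm_self _ _).trans (norm_characterError_le χ hx.le)
  have hfm : Measurable f := (measurable_characterError χ).indicator measurableSet_Ioi
  have hm : DifferentiableAt ℂ (mellin f) (-s) := by
    refine mellin_differentiableAt_of_isBigO_rpow (a := 0) (b := -s.re - 1) ?_ ?_ (by simpa) ?_
      (by simp)
    · refine (locallyIntegrableOn_iff isLocallyClosed_Ioi).2 fun K hK hKc => ?_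
      refine Integrable.mono' (g := fun _ => (4 * q : ℝ)) ?_ hfm.aestronglyMeasurable ?_
      · exact integrableOn_const hKc.measure_lt_top.ne
      · exact (ae_restrict_iff' hKc.measurableSet).2 (ae_of_all _ fun x hx => hfb x (hK hx))
    · refine IsBigO.of_bound (4 * q) ?_
      filter_upwards [eventually_gt_atTop 0] with x hx
      simpa using hfb x hx
    · refine IsBigO.of_bound 1 ?_
      filter_upwards [mem_nhdsWithin_of_mem_nhds (Iio_mem_nhds zero_lt_one)] with x hx
      have : f x = 0 := Set.indicator_of_notMem (by simpa using le_of_lt hx) _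
      rw [this]
      simp
  have heq : characterIntegral χ = fun s => mellin f (-s) := by
    funext s
    rw [characterIntegral, mellin]
    have h1 : ∀ t : ℝ, (t : ℂ) ^ (-s - 1) • f t
        = (Set.Ioi (1 : ℝ)).indicator (fun t => characterError χ t * (t : ℂ) ^ (-(s + 1))) t := by
      intro t
      by_cases ht : t ∈ Set.Ioi (1 : ℝ)
      · rw [Set.indicator_of_mem ht]
        simp only [f]
        rw [Set.indicator_of_mem ht, smul_eq_mul, mul_comm]
        congr 2
        ring
      · simp only [f]
        rw [Set.indicator_of_notMem ht, Set.indicator_of_notMem ht, smul_zero]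
    simp_rw [h1]
    rw [setIntegral_indicator measurableSet_Ioi, Set.inter_eq_right.2]
    exact Set.Ioi_subset_Ioi zero_le_one
  rw [heq]
  exact hm.comp s differentiableAt_id.neg

lemma LSeries_eq_characterIntegral (χ : DirichletCharacter ℂ q) {s : ℂ} (hs : 1 < s.re) :
    LSeries (χ ·) s = s * characterIntegral χ s + s * characterMean χ / (s - 1) := by
  have hO : (fun n : ℕ => ∑ k ∈ Finset.Icc 1 n, ‖χ (k : ZMod q)‖)
      =O[atTop] fun n => (n : ℝ) ^ (1 : ℝ) := by
    refine IsBigO.of_bound 1 (Eventually.of_forall fun n => ?_)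
    rw [Real.rpow_one, one_mul, Real.norm_of_nonneg (Finset.sum_nonneg fun _ _ => norm_nonneg _),
      Real.norm_of_nonneg (Nat.cast_nonneg n)]
    refine (Finset.sum_le_sum fun (a : ℕ) _ => χ.norm_le_one (a : ZMod q)).trans ?_
    simp
  have hs1 : s - 1 ≠ 0 := by
    intro h
    have := congrArg re h
    simp at this
    linarith
  have hi : IntegrableOn (fun t : ℝ => characterMean χ * (t : ℂ) ^ (-s)) (Set.Ioi 1) :=
    (integrableOn_Ioi_cpow_of_lt (by simpa using hs) one_pos).const_mul _
  rw [LSeries_eq_mul_integral' (χ ·) zero_le_one hs hO, mul_div_assoc, ← mul_add,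
    characterIntegral]
  congr 1
  have h2 : ∫ t in Set.Ioi (1 : ℝ), characterMean χ * (t : ℂ) ^ (-s)
      = characterMean χ / (s - 1) := by
    rw [integral_const_mul, integral_Ioi_cpow_of_lt (by simpa using hs) one_pos]
    have : -s + 1 ≠ 0 := by
      intro h
      apply hs1
      linear_combination -h
    simp only [ofReal_one, one_cpow]
    field_simp
    ring
  rw [← h2, ← integral_add (integrableOn_characterError χ (by linarith)) hi]
  refine setIntegral_congr_fun measurableSet_Ioi fun t ht => ?_
  have ht0 : (t : ℂ) ≠ 0 := by exact_mod_cast (zero_lt_one.trans ht).ne'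
  have h3 : (t : ℂ) ^ (-s) = t * (t : ℂ) ^ (-(s + 1)) := by
    rw [show -s = 1 + -(s + 1) by ring, cpow_add _ _ ht0, cpow_one]
  simp only [h3, characterError]
  ring

/-- The entire function attached to a Dirichlet character: its L-function, multiplied by `s - 1`
when the character is principal. -/
noncomputable def entireL (χ : DirichletCharacter ℂ q) : ℂ → ℂ :=
  if χ = 1 then DirichletCharacter.LFunctionTrivChar₁ q else χ.LFunction

lemma differentiable_entireL (χ : DirichletCharacter ℂ q) : Differentiable ℂ (entireL χ) := by
  unfold entireL
  split_ifs with h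
  · exact DirichletCharacter.differentiable_LFunctionTrivChar₁ q
  · exact DirichletCharacter.differentiable_LFunction h

lemma entireL_of_ne_one {χ : DirichletCharacter ℂ q} (h : χ ≠ 1) : entireL χ = χ.LFunction :=
  if_neg h

lemma entireL_one {s : ℂ} (hs : s ≠ 1) :
    entireL (1 : DirichletCharacter ℂ q) s
      = (s - 1) * DirichletCharacter.LFunction (1 : DirichletCharacter ℂ q) s := by
  rw [entireL, if_pos rfl, DirichletCharacter.LFunctionTrivChar₁, Function.update_of_ne hs]

lemma eqOn_re_pos_of_eqOn_one_lt_re {f g : ℂ → ℂ} (hf : Differentiable ℂ f)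
    (hg : ∀ s : ℂ, 0 < s.re → DifferentiableAt ℂ g s) (h : ∀ s : ℂ, 1 < s.re → f s = g s)
    {s : ℂ} (hs : 0 < s.re) : f s = g s := by
  have ho : IsOpen {s : ℂ | 0 < s.re} := isOpen_lt continuous_const continuous_re
  have ho1 : IsOpen {s : ℂ | 1 < s.re} := isOpen_lt continuous_const continuous_re
  have hfa : AnalyticOnNhd ℂ f {s : ℂ | 0 < s.re} := fun z _ => hf.analyticAt z
  have hga : AnalyticOnNhd ℂ g {s : ℂ | 0 < s.re} :=
    DifferentiableOn.analyticOnNhd (fun z hz => (hg z hz).differentiableWithinAt) ho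
  have hev : f =ᶠ[nhds 2] g := by
    filter_upwards [ho1.mem_nhds (show (2 : ℂ) ∈ {s : ℂ | 1 < s.re} by simp)] with z hz
    exact h z hz
  exact hfa.eqOn_of_preconnected_of_eventuallyEq hga
    (convex_halfSpace_re_gt 0).isPreconnected (show (2 : ℂ) ∈ {s : ℂ | 0 < s.re} by simp) hev hs

lemma norm_entireL_le (χ : DirichletCharacter ℂ q) {s : ℂ} (hs : 1 / 2 ≤ s.re) :
    ‖entireL χ s‖ ≤ 8 * q * (‖s‖ + 1) ^ 2 := by
  have hs0 : 0 < s.re := by linarith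
  have hq : (1 : ℝ) ≤ q := by exact_mod_cast NeZero.pos q
  have hI : ‖characterIntegral χ s‖ ≤ 8 * q := by
    refine (norm_characterIntegral_le χ hs0).trans ?_
    rw [div_le_iff₀ hs0]
    nlinarith
  have hn := norm_nonneg s
  by_cases hχ : χ = 1
  · subst hχ
    have h1 : entireL (1 : DirichletCharacter ℂ q) s
        = (s - 1) * (s * characterIntegral (1 : DirichletCharacter ℂ q) s)
          + s * characterMean (1 : DirichletCharacter ℂ q) := by
      refine eqOn_re_pos_of_eqOn_one_lt_re (differentiable_entireL 1) (g := fun s =>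
        (s - 1) * (s * characterIntegral (1 : DirichletCharacter ℂ q) s)
          + s * characterMean (1 : DirichletCharacter ℂ q))
        (fun z hz => ?_) (fun z hz => ?_) hs0
      · have := differentiableAt_characterIntegral (1 : DirichletCharacter ℂ q) hz
        fun_prop
      · have hz1 : z - 1 ≠ 0 := by
          intro h
          have := congrArg re h
          simp at this
          linarith
        rw [entireL_one (sub_ne_zero.1 hz1), DirichletCharacter.LFunction_eq_LSeries _ hz,
          LSeries_eq_characterIntegral _ hz]
        field_simp
    have h2 : ‖s - 1‖ ≤ ‖s‖ + 1 := (norm_sub_le _ _).trans (by simp)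
    rw [h1]
    calc _ ≤ ‖s - 1‖ * (‖s‖ * ‖characterIntegral (1 : DirichletCharacter ℂ q) s‖)
          + ‖s‖ * ‖characterMean (1 : DirichletCharacter ℂ q)‖ := by
          refine (norm_add_le _ _).trans_eq ?_
          simp only [norm_mul]
      _ ≤ (‖s‖ + 1) * (‖s‖ * (8 * q)) + ‖s‖ * 1 := by
          gcongr
          exact norm_characterMean_le _
      _ ≤ _ := by nlinarith
  · have h1 : entireL χ s = s * characterIntegral χ s := by
      refine eqOn_re_pos_of_eqOn_one_lt_re (differentiable_entireL χ) (g := fun s =>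
        s * characterIntegral χ s) (fun z hz => ?_) (fun z hz => ?_) hs0
      · exact differentiableAt_id.mul (differentiableAt_characterIntegral χ hz)
      · rw [entireL_of_ne_one hχ, DirichletCharacter.LFunction_eq_LSeries _ hz,
          LSeries_eq_characterIntegral _ hz, characterMean_eq_zero hχ]
        simp
    rw [h1, norm_mul]
    calc _ ≤ ‖s‖ * (8 * q) := by gcongr
      _ ≤ _ := by nlinarith [mul_nonneg hn (zero_le_one.trans hq)]

end Growth

/-! ### The logarithmic derivative of a Dirichlet L-function to the right of the critical strip -/

section LogarithmicDerivative

open Complex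

variable {q : ℕ} [NeZero q]

lemma tsum_one_div_rpow_le {σ : ℝ} (hσ : 1 < σ) :
    ∑' n : ℕ, 1 / (n + 1 : ℝ) ^ σ ≤ 1 + 1 / (σ - 1) := by
  have h1 := ZetaAsymptotics.zeta_limit_aux1 hσ
  have h2 : 0 ≤ ZetaAsymptotics.termTSum σ :=
    tsum_nonneg fun n => ZetaAsymptotics.term_nonneg (n + 1) σ
  nlinarith

lemma norm_LSeries_le_of_norm_le_one {f : ℕ → ℂ} (hf : ∀ n, ‖f n‖ ≤ 1) {s : ℂ} (hs : 1 < s.re) :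
    ‖LSeries f s‖ ≤ 1 + 1 / (s.re - 1) := by
  have hsum : Summable fun n : ℕ => 1 / (n + 1 : ℝ) ^ s.re := by
    have := (summable_nat_add_iff 1).2 (Real.summable_one_div_nat_rpow.2 hs)
    simpa using this
  have hle : ∀ n : ℕ, ‖LSeries.term f s (n + 1)‖ ≤ 1 / (n + 1 : ℝ) ^ s.re := by
    intro n
    rw [LSeries.norm_term_eq, if_neg n.succ_ne_zero]
    push_cast
    gcongr
    exact hf _
  have hsum' : Summable (LSeries.term f s) :=
    (summable_nat_add_iff 1).1 (Summable.of_norm_bounded hsum hle)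
  rw [LSeries, hsum'.tsum_eq_zero_add, LSeries.term_zero, zero_add]
  exact (tsum_of_norm_bounded hsum.hasSum hle).trans (tsum_one_div_rpow_le hs)

lemma le_norm_LFunction (χ : DirichletCharacter ℂ q) {s : ℂ} (hs : 1 < s.re) (hs2 : s.re ≤ 2) :
    (s.re - 1) / 2 ≤ ‖χ.LFunction s‖ := by
  have h1 := congrArg norm (DirichletCharacter.LSeries.mul_mu_eq_one χ hs)
  rw [norm_mul, norm_one, ← χ.LFunction_eq_LSeries hs] at h1
  have h2 := norm_LSeries_le_of_norm_le_one (s := s)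
    (f := (fun n : ℕ => χ (n : ZMod q)) * fun n : ℕ => ((ArithmeticFunction.moebius n : ℤ) : ℂ))
    (fun n => by
      rw [Pi.mul_apply, norm_mul]
      refine mul_le_one₀ (χ.norm_le_one _) (norm_nonneg _) ?_
      rw [Complex.norm_intCast]
      exact_mod_cast ArithmeticFunction.abs_moebius_le_one) hs
  have h3 : 0 < s.re - 1 := by linarith
  have h4 : (1 + 1 / (s.re - 1)) * ((s.re - 1) / 2) ≤ 1 := by
    field_simp
    linarith
  by_contra! h
  have h5 : 0 < 1 + 1 / (s.re - 1) := by positivity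
  have h6 : ‖χ.LFunction s‖ * (1 + 1 / (s.re - 1)) < 1 := by nlinarith
  nlinarith [norm_nonneg (χ.LFunction s),
    mul_le_mul_of_nonneg_left h2 (norm_nonneg (χ.LFunction s))]

lemma le_norm_entireL (χ : DirichletCharacter ℂ q) {s : ℂ} (hs : 1 < s.re) (hs2 : s.re ≤ 2) :
    (s.re - 1) ^ 2 / 2 ≤ ‖entireL χ s‖ := by
  have h := le_norm_LFunction χ hs hs2
  by_cases hχ : χ = 1
  · subst hχ
    have hs1 : s ≠ 1 := by
      rintro rfl
      simp at hs
    rw [entireL_one hs1, norm_mul]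
    have h1 := Complex.re_le_norm (s - 1)
    rw [sub_re, one_re] at h1
    calc _ = (s.re - 1) * ((s.re - 1) / 2) := by ring
      _ ≤ _ := by gcongr
  · rw [entireL_of_ne_one hχ]
    nlinarith

lemma entireL_ne_zero (χ : DirichletCharacter ℂ q) {s : ℂ} (hs : 1 < s.re) :
    entireL χ s ≠ 0 := by
  have h0 : χ.LFunction s ≠ 0 := by
    rw [χ.LFunction_eq_LSeries hs]
    exact χ.LSeries_ne_zero_of_one_lt_re hs
  by_cases hχ : χ = 1
  · subst hχ
    have hs1 : s ≠ 1 := by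
      rintro rfl
      simp at hs
    rw [entireL_one hs1]
    exact mul_ne_zero (sub_ne_zero.2 hs1) h0
  · rwa [entireL_of_ne_one hχ]

/-- The conductor-type quantity `log (q (2 + |t|))`. -/
noncomputable def logConductor (q : ℕ) (t : ℝ) : ℝ := Real.log (q * (2 + |t|))

lemma re_neg_logDeriv_entireL_le (hq : 2 ≤ q) (χ : DirichletCharacter ℂ q) {s : ℂ} {l : ℝ}
    (hl : logConductor q s.im ≤ l) (hs : Real.exp (-l) ≤ s.re - 1) (hs2 : s.re ≤ 5 / 4)
    {g₀ : ℂ → ℂ} (hg₀ : Differentiable ℂ g₀) (S : Multiset ℂ) (hS : ∀ ρ ∈ S, ‖s - ρ‖ < 1 / 4)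
    (hfS : ∀ z, entireL χ z = (S.map fun ρ => z - ρ).prod * g₀ z) :
    (-logDeriv (entireL χ) s).re ≤ 112 * l + (S.map fun ρ => 4 - (1 / (s - ρ)).re).sum := by
  have hqr : (2 : ℝ) ≤ q := by exact_mod_cast hq
  set T := 2 + |s.im| with hT
  have hT2 : 2 ≤ T := by linarith [abs_nonneg s.im]
  obtain ⟨Q, hQdef⟩ : ∃ Q, Q = Real.exp l := ⟨_, rfl⟩
  have hqT : q * T ≤ Q := by
    rw [hQdef, ← Real.log_le_iff_le_exp (by positivity)]
    exact hl
  have hQ : 4 ≤ Q := by nlinarith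
  have hQT : T ≤ Q := by nlinarith
  have hQ0 : 0 < Q := by linarith
  have hlog : l = Real.log Q := by rw [hQdef, Real.log_exp]
  rw [Real.exp_neg, ← hQdef] at hs
  have hs1 : 1 < s.re := by
    have : 0 < Q⁻¹ := by positivity
    linarith
  have hlog0 : 0 < Real.log Q := Real.log_pos (by linarith)
  let f : ℂ → ℂ := fun z => entireL χ (s + z)
  have hf : Differentiable ℂ f := (differentiable_entireL χ).comp (by fun_prop)
  have hfd : logDeriv f 0 = logDeriv (entireL χ) s := by
    simp only [f, logDeriv_apply]
    rw [deriv_comp_const_add, add_zero]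
  have hexpM : Real.exp (7 * Real.log Q) = Q ^ 7 := by
    rw [show (7 : ℝ) * Real.log Q = ((7 : ℕ) : ℝ) * Real.log Q by norm_num, Real.exp_nat_mul,
      Real.exp_log hQ0]
  have hf0 : Q⁻¹ ^ 2 / 2 ≤ ‖f 0‖ := by
    have h1 := le_norm_entireL χ hs1 (by linarith)
    simp only [f, add_zero]
    refine le_trans ?_ h1
    gcongr
  have hb : ∀ z ∈ Metric.closedBall (0 : ℂ) (2 * (1 / 4)),
      ‖f z‖ ≤ ‖f 0‖ * Real.exp (7 * Real.log Q) := by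
    intro z hz
    have hz' : ‖z‖ ≤ 1 / 2 := by
      rw [mem_closedBall_zero_iff] at hz
      linarith
    have hzre : 1 / 2 ≤ (s + z).re := by
      have := (abs_le.1 ((Complex.abs_re_le_norm z).trans hz')).1
      rw [add_re]
      linarith
    have hn : ‖s + z‖ + 1 ≤ 2 * T := by
      have h1 := norm_add_le s z
      have h2 := Complex.norm_le_abs_re_add_abs_im s
      rw [abs_of_pos (by linarith : 0 < s.re)] at h2
      linarith
    have h3 : ‖f z‖ ≤ 32 * Q ^ 2 := by
      calc ‖f z‖ ≤ 8 * q * (‖s + z‖ + 1) ^ 2 := norm_entireL_le χ hzre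
        _ ≤ 8 * q * (2 * T) ^ 2 := by gcongr
        _ = 32 * (q * T) * T := by ring
        _ ≤ 32 * Q * Q := by gcongr
        _ = 32 * Q ^ 2 := by ring
    have h4 : Q⁻¹ ^ 2 / 2 * Q ^ 7 = Q ^ 5 / 2 := by
      field_simp
    have h5 : (4 : ℝ) ^ 3 ≤ Q ^ 3 := by gcongr
    rw [hexpM]
    calc ‖f z‖ ≤ 32 * Q ^ 2 := h3
      _ ≤ Q ^ 5 / 2 := by nlinarith [sq_nonneg Q]
      _ = Q⁻¹ ^ 2 / 2 * Q ^ 7 := h4.symm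
      _ ≤ _ := by gcongr
  have hre : ∀ z ∈ Metric.ball (0 : ℂ) (1 / 4), f z = 0 → z.re ≤ 0 := by
    intro z _ hz
    by_contra! h
    exact entireL_ne_zero χ (by rw [add_re]; linarith) hz
  have key := re_neg_logDeriv_le (f := f) (g₀ := fun z => g₀ (s + z)) (r := 1 / 4)
    (M := 7 * Real.log Q) (by norm_num) (by positivity) hf
    (by simpa [f] using entireL_ne_zero χ hs1) hb hre (hg₀.comp (by fun_prop))
    (S.map fun ρ => ρ - s)
    (by
      intro ρ hρ
      obtain ⟨ρ', h1, rfl⟩ := Multiset.mem_map.1 hρ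
      rw [mem_ball_zero_iff, norm_sub_rev]
      exact hS _ h1)
    (by
      intro z
      simp only [f, hfS (s + z), Multiset.map_map, Function.comp_def]
      congr 3
      funext ρ
      ring)
  rw [hfd, Multiset.map_map] at key
  rw [hlog]
  refine key.trans_eq ?_
  congr 1
  · ring
  · congr 2
    funext ρ
    rw [Function.comp_apply, ← neg_sub s ρ, div_neg, neg_re]
    ring

end LogarithmicDerivative

/-! ### Positivity of combinations of logarithmic derivatives -/

section Positivity

open Complex

variable {q : ℕ} [NeZero q]

lemma hasSum_neg_logDeriv_LFunction (χ : DirichletCharacter ℂ q) {s : ℂ} (hs : 1 < s.re) :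
    HasSum (fun n : ℕ => ArithmeticFunction.vonMangoldt n * (χ (n : ZMod q) * (n : ℂ) ^ (-s)).re)
      (-logDeriv χ.LFunction s).re := by
  have h1 := (χ.LSeriesSummable_twist_vonMangoldt hs).LSeriesHasSum
  rw [χ.LSeries_twist_vonMangoldt_eq hs, ← χ.deriv_LFunction_eq_deriv_LSeries hs,
    ← χ.LFunction_eq_LSeries hs, neg_div, ← logDeriv_apply] at h1
  convert! Complex.hasSum_re h1 using 2 with n
  rw [LSeries.term_def₀ (by simp), Pi.mul_apply, ← re_ofReal_mul]
  ring_nf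

lemma natCast_cpow_neg_ofReal (n : ℕ) (σ : ℝ) :
    (n : ℂ) ^ (-(σ : ℂ)) = ((n : ℝ) ^ (-σ) : ℝ) := by
  rw [ofReal_cpow n.cast_nonneg]
  simp

lemma vonMangoldt_mul_rpow_nonneg (n : ℕ) (σ : ℝ) :
    0 ≤ ArithmeticFunction.vonMangoldt n * (n : ℝ) ^ (-σ) :=
  mul_nonneg ArithmeticFunction.vonMangoldt_nonneg (by positivity)

lemma neg_one_le_re_character {q : ℕ} (χ : DirichletCharacter ℂ q) (a : ZMod q) : -1 ≤ (χ a).re :=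
  (abs_le.1 ((Complex.abs_re_le_norm _).trans (χ.norm_le_one a))).1

lemma three_four_one (χ : DirichletCharacter ℂ q) {σ : ℝ} (hσ : 1 < σ) (t : ℝ) :
    0 ≤ 3 * (-logDeriv (DirichletCharacter.LFunction (1 : DirichletCharacter ℂ q)) σ).re
      + 4 * (-logDeriv χ.LFunction (σ + t * I)).re
      + (-logDeriv (χ ^ 2).LFunction (σ + (2 * t : ℝ) * I)).re := by
  refine ((((hasSum_neg_logDeriv_LFunction 1 (by simpa)).mul_left 3).add
    ((hasSum_neg_logDeriv_LFunction χ (by simpa)).mul_left 4)).add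
    (hasSum_neg_logDeriv_LFunction (χ ^ 2) (by simpa))).nonneg fun n => ?_
  rcases Nat.eq_zero_or_pos n with rfl | hn
  · simp
  have hn0 : (n : ℂ) ≠ 0 := by exact_mod_cast hn.ne'
  by_cases hu : IsUnit (n : ZMod q)
  swap
  · simp [MulChar.map_nonunit _ hu]
  obtain ⟨w, hw⟩ : ∃ w : ℂ, w = χ n * (n : ℂ) ^ (-(t * I)) := ⟨_, rfl⟩
  have hwn : ‖w‖ = 1 := by
    rw [hw, norm_mul, ← hu.unit_spec, χ.unit_norm_eq_one, norm_natCast_cpow_of_pos hn]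
    simp
  have hp := natCast_cpow_neg_ofReal n σ
  have h1 : (1 : DirichletCharacter ℂ q) n * (n : ℂ) ^ (-(σ : ℂ)) = ((n : ℝ) ^ (-σ) : ℝ) := by
    rw [hp, MulChar.one_apply hu, one_mul]
  have h2 : χ n * (n : ℂ) ^ (-(σ + t * I)) = ((n : ℝ) ^ (-σ) : ℝ) * w := by
    rw [neg_add, cpow_add _ _ hn0, hp, hw]
    ring
  have h3 : (χ ^ 2) n * (n : ℂ) ^ (-(σ + (2 * t : ℝ) * I)) = ((n : ℝ) ^ (-σ) : ℝ) * w ^ 2 := by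
    rw [neg_add, cpow_add _ _ hn0, hp, hw, mul_pow, ← cpow_nat_mul,
      MulChar.pow_apply' _ two_ne_zero]
    push_cast
    ring_nf
  rw [h1, h2, h3, re_ofReal_mul, re_ofReal_mul, ofReal_re]
  have h4 : w.re ^ 2 + w.im ^ 2 = 1 := by
    have := Complex.sq_norm w
    rw [hwn, normSq_apply] at this
    linarith
  have h5 : 3 + 4 * w.re + (w ^ 2).re = 2 * (1 + w.re) ^ 2 := by
    rw [sq w, mul_re]
    nlinarith
  have h6 := vonMangoldt_mul_rpow_nonneg n σ
  nlinarith [mul_nonneg h6 (mul_nonneg zero_le_two (sq_nonneg (1 + w.re)))]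

lemma one_one (χ : DirichletCharacter ℂ q) {σ : ℝ} (hσ : 1 < σ) :
    0 ≤ (-logDeriv (DirichletCharacter.LFunction (1 : DirichletCharacter ℂ q)) σ).re
      + (-logDeriv χ.LFunction σ).re := by
  refine ((hasSum_neg_logDeriv_LFunction 1 (by simpa)).add
    (hasSum_neg_logDeriv_LFunction χ (by simpa))).nonneg fun n => ?_
  by_cases hu : IsUnit (n : ZMod q)
  swap
  · simp [MulChar.map_nonunit _ hu]
  rw [natCast_cpow_neg_ofReal, MulChar.one_apply hu, one_mul, ofReal_re, re_mul_ofReal]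
  nlinarith [mul_nonneg (vonMangoldt_mul_rpow_nonneg n σ)
    (neg_le_iff_add_nonneg.1 (neg_one_le_re_character χ n))]

lemma one_one_one_one {χ₁ χ₂ : DirichletCharacter ℂ q} (h₁ : χ₁.IsReal)
    {σ : ℝ} (hσ : 1 < σ) :
    0 ≤ (-logDeriv (DirichletCharacter.LFunction (1 : DirichletCharacter ℂ q)) σ).re
      + (-logDeriv χ₁.LFunction σ).re + (-logDeriv χ₂.LFunction σ).re
      + (-logDeriv (χ₁ * χ₂).LFunction σ).re := by
  refine ((((hasSum_neg_logDeriv_LFunction 1 (by simpa)).add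
    (hasSum_neg_logDeriv_LFunction χ₁ (by simpa))).add
    (hasSum_neg_logDeriv_LFunction χ₂ (by simpa))).add
    (hasSum_neg_logDeriv_LFunction (χ₁ * χ₂) (by simpa))).nonneg fun n => ?_
  by_cases hu : IsUnit (n : ZMod q)
  swap
  · simp [MulChar.map_nonunit _ hu]
  rw [natCast_cpow_neg_ofReal, MulChar.one_apply hu, one_mul, ofReal_re, re_mul_ofReal,
    re_mul_ofReal, re_mul_ofReal, MulChar.mul_apply, mul_re, conj_eq_iff_im.1 (h₁ n).symm, zero_mul,
    sub_zero]
  nlinarith [mul_nonneg (vonMangoldt_mul_rpow_nonneg n σ)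
    (mul_nonneg (neg_le_iff_add_nonneg.1 (neg_one_le_re_character χ₁ n))
      (neg_le_iff_add_nonneg.1 (neg_one_le_re_character χ₂ n)))]

end Positivity

/-! ### The logarithmic derivative in the presence of zeros -/

section Zeros

open Complex

lemma exists_factor_of_zero {f : ℂ → ℂ} (hf : Differentiable ℂ f) {ρ : ℂ} (h : f ρ = 0) :
    Differentiable ℂ (dslope f ρ) ∧ ∀ z, f z = (z - ρ) * dslope f ρ z := by
  refine ⟨?_, fun z => ?_⟩
  · rw [← differentiableOn_univ] at hf ⊢
    exact (Complex.differentiableOn_dslope Filter.univ_mem).2 hf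
  · have := sub_smul_dslope f ρ z
    rw [h, sub_zero, smul_eq_mul] at this
    exact this.symm

lemma exists_factor_of_two_zeros {f : ℂ → ℂ} (hf : Differentiable ℂ f) {ρ₁ ρ₂ : ℂ}
    (h₁ : f ρ₁ = 0) (h₂ : f ρ₂ = 0) (h : ρ₁ = ρ₂ → deriv f ρ₁ = 0) :
    ∃ g₀ : ℂ → ℂ, Differentiable ℂ g₀ ∧ ∀ z, f z = (z - ρ₁) * ((z - ρ₂) * g₀ z) := by
  obtain ⟨hd, hfac⟩ := exists_factor_of_zero hf h₁
  have h3 : dslope f ρ₁ ρ₂ = 0 := by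
    by_cases h12 : ρ₁ = ρ₂
    · rw [← h12, dslope_same, h h12]
    · have := hfac ρ₂
      rw [h₂] at this
      exact (mul_eq_zero.1 this.symm).resolve_left (sub_ne_zero.2 (Ne.symm h12))
  obtain ⟨hd2, hfac2⟩ := exists_factor_of_zero hd h3
  exact ⟨_, hd2, fun z => by rw [hfac z, hfac2 z]⟩

variable {q : ℕ} [NeZero q]

/-- The contribution of the pole at `1` to the negative logarithmic derivative. -/
noncomputable def polarPart (χ : DirichletCharacter ℂ q) (s : ℂ) : ℝ :=
  if χ = 1 then (1 / (s - 1)).re else 0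

lemma re_neg_logDeriv_LFunction (χ : DirichletCharacter ℂ q) {s : ℂ} (hs : 1 < s.re) :
    (-logDeriv χ.LFunction s).re = polarPart χ s + (-logDeriv (entireL χ) s).re := by
  by_cases hχ : χ = 1
  · subst hχ
    have hs1 : s ≠ 1 := by
      rintro rfl
      simp at hs
    have hL : DirichletCharacter.LFunction (1 : DirichletCharacter ℂ q) s ≠ 0 := by
      rw [DirichletCharacter.LFunction_eq_LSeries _ hs]
      exact DirichletCharacter.LSeries_ne_zero_of_one_lt_re _ hs
    have heq : entireL (1 : DirichletCharacter ℂ q) =ᶠ[nhds s]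
        fun z => (z - 1) * DirichletCharacter.LFunction (1 : DirichletCharacter ℂ q) z := by
      filter_upwards [isOpen_ne.mem_nhds hs1] with z hz
      exact entireL_one hz
    have h1 : logDeriv (entireL (1 : DirichletCharacter ℂ q)) s
        = 1 / (s - 1) + logDeriv (DirichletCharacter.LFunction (1 : DirichletCharacter ℂ q)) s := by
      rw [logDeriv_apply, heq.deriv_eq, heq.eq_of_nhds, ← logDeriv_apply
        (f := fun z => (z - 1) * DirichletCharacter.LFunction (1 : DirichletCharacter ℂ q) z),
        logDeriv_mul (f := fun z => z - 1) s (sub_ne_zero.2 hs1) hL (by fun_prop)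
        (DirichletCharacter.differentiableAt_LFunction _ s (Or.inl hs1))]
      congr 1
      rw [logDeriv_apply, deriv_sub_const, deriv_id'']
    rw [h1, polarPart, if_pos rfl]
    simp only [neg_re, add_re]
    ring
  · rw [polarPart, if_neg hχ, zero_add, entireL_of_ne_one hχ]

lemma re_neg_logDeriv_LFunction_le (hq : 2 ≤ q) (χ : DirichletCharacter ℂ q) {s : ℂ}
    {l : ℝ} (hl : logConductor q s.im ≤ l) (hs : Real.exp (-l) ≤ s.re - 1) (hs2 : s.re ≤ 5 / 4) :
    (-logDeriv χ.LFunction s).re ≤ polarPart χ s + 112 * l := by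
  rw [re_neg_logDeriv_LFunction χ (by linarith [Real.exp_pos (-l)])]
  have := re_neg_logDeriv_entireL_le hq χ hl hs hs2 (differentiable_entireL χ) 0 (by simp) (by simp)
  simp only [Multiset.map_zero, Multiset.sum_zero, add_zero] at this
  linarith

lemma re_neg_logDeriv_LFunction_le_of_zero (hq : 2 ≤ q) (χ : DirichletCharacter ℂ q) {s ρ : ℂ}
    {l : ℝ} (hl : logConductor q s.im ≤ l) (hs : Real.exp (-l) ≤ s.re - 1) (hs2 : s.re ≤ 5 / 4)
    (hρ : entireL χ ρ = 0) (hsρ : ‖s - ρ‖ < 1 / 4) :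
    (-logDeriv χ.LFunction s).re ≤
      polarPart χ s + 112 * l + 4 - (1 / (s - ρ)).re := by
  rw [re_neg_logDeriv_LFunction χ (by linarith [Real.exp_pos (-l)])]
  obtain ⟨hd, hfac⟩ := exists_factor_of_zero (differentiable_entireL χ) hρ
  have := re_neg_logDeriv_entireL_le hq χ hl hs hs2 hd {ρ} (by simpa using hsρ) (by simpa)
  simp only [Multiset.map_singleton, Multiset.sum_singleton] at this
  linarith

lemma re_neg_logDeriv_LFunction_le_of_two_zeros (hq : 2 ≤ q) (χ : DirichletCharacter ℂ q)
    {s ρ₁ ρ₂ : ℂ} {l : ℝ} (hl : logConductor q s.im ≤ l) (hs : Real.exp (-l) ≤ s.re - 1)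
    (hs2 : s.re ≤ 5 / 4) (h₁ : entireL χ ρ₁ = 0) (h₂ : entireL χ ρ₂ = 0)
    (h : ρ₁ = ρ₂ → deriv (entireL χ) ρ₁ = 0)
    (hs₁ : ‖s - ρ₁‖ < 1 / 4) (hs₂ : ‖s - ρ₂‖ < 1 / 4) :
    (-logDeriv χ.LFunction s).re ≤
      polarPart χ s + 112 * l + 8 - (1 / (s - ρ₁)).re - (1 / (s - ρ₂)).re := by
  rw [re_neg_logDeriv_LFunction χ (by linarith [Real.exp_pos (-l)])]
  obtain ⟨g₀, hd, hfac⟩ := exists_factor_of_two_zeros (differentiable_entireL χ) h₁ h₂ h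
  have := re_neg_logDeriv_entireL_le hq χ hl hs hs2 hd {ρ₁, ρ₂} (by
    simp only [Multiset.insert_eq_cons, Multiset.mem_cons, Multiset.mem_singleton]
    rintro _ (rfl | rfl) <;> assumption)
    (by simpa [mul_assoc] using hfac)
  simp only [Multiset.insert_eq_cons, Multiset.map_cons, Multiset.map_singleton,
    Multiset.sum_cons, Multiset.sum_singleton] at this
  linarith

end Zeros

/-! ### The principal character -/

section Principal

open Complex Filter Topology

variable {q : ℕ} [NeZero q]

lemma one_sub_prime_cpow_ne_zero {p : ℕ} (hp : p.Prime) {s : ℂ} (hs : 0 < s.re) :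
    1 - (p : ℂ) ^ (-s) ≠ 0 := by
  intro h
  have h1 : ‖(p : ℂ) ^ (-s)‖ < 1 := by
    rw [norm_natCast_cpow_of_pos hp.pos]
    exact Real.rpow_lt_one_of_one_lt_of_neg (by exact_mod_cast hp.one_lt) (by simpa)
  rw [← sub_eq_zero.1 h, norm_one] at h1
  exact lt_irrefl _ h1

lemma riemannZeta_eq_zero_of_LFunction_one {s : ℂ} (hs : 0 < s.re) (hs1 : s ≠ 1)
    (h : DirichletCharacter.LFunction (1 : DirichletCharacter ℂ q) s = 0) : riemannZeta s = 0 := by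
  have h1 := DirichletCharacter.LFunctionTrivChar_eq_mul_riemannZeta (N := q) hs1
  rw [DirichletCharacter.LFunctionTrivChar, h] at h1
  refine (mul_eq_zero.1 h1.symm).resolve_left (Finset.prod_ne_zero_iff.2 fun p hp => ?_)
  exact one_sub_prime_cpow_ne_zero (Nat.prime_of_mem_primeFactors hp) hs

lemma exists_LFunction_one_ne_zero : ∃ r : ℝ, 0 < r ∧ r < 1 ∧ ∀ (q : ℕ) [NeZero q] (s : ℂ), s ≠ 1 →
    ‖s - 1‖ < r → DirichletCharacter.LFunction (1 : DirichletCharacter ℂ q) s ≠ 0 := by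
  obtain ⟨r, hr, h⟩ := Metric.eventually_nhds_iff.1 riemannZeta_eventually_ne_zero_nhds_one
  refine ⟨min r (1 / 2), by positivity, by simp; norm_num, fun q _ s hs1 hs h0 => ?_⟩
  refine h (y := s) ?_ (riemannZeta_eq_zero_of_LFunction_one ?_ hs1 h0)
  · rw [dist_eq]
    exact hs.trans_le (min_le_left _ _)
  · have h1 := (abs_lt.1 ((Complex.abs_re_le_norm _).trans_lt
      (hs.trans_le (min_le_right _ _)))).1
    rw [sub_re, one_re] at h1
    linarith

lemma prod_one_sub_inv_eq (q : ℕ) [NeZero q] :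
    ∏ p ∈ q.primeFactors, (1 - (p : ℂ)⁻¹)
      = (∑ j : ZMod q, (1 : DirichletCharacter ℂ q) j) / q := by
  rw [Finset.sum_div]
  exact tendsto_nhds_unique (DirichletCharacter.LFunctionTrivChar_residue_one (N := q))
    (ZMod.LFunction_residue_one _)

lemma tendsto_LFunction_one_sub (q : ℕ) [NeZero q] :
    Tendsto (fun s : ℂ => DirichletCharacter.LFunction (1 : DirichletCharacter ℂ q) s
      - (q : ℂ) ^ (1 - s) * (∏ p ∈ q.primeFactors, (1 - (p : ℂ)⁻¹)) * (1 / (s - 1) / Gammaℝ s))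
      (𝓝 1) (𝓝 (DirichletCharacter.LFunction (1 : DirichletCharacter ℂ q) 1)) := by
  have hq : (q : ℂ) ≠ 0 := by exact_mod_cast NeZero.ne q
  have h1 : Tendsto (fun s : ℂ => (q : ℂ) ^ (-s)) (𝓝 1) (𝓝 ((q : ℂ) ^ (-1 : ℂ))) :=
    (continuous_neg.const_cpow (Or.inl hq)).tendsto 1
  have h2 := h1.mul (tendsto_finsetSum Finset.univ fun (j : ZMod q) _ =>
    (HurwitzZeta.tendsto_hurwitzZeta_sub_one_div_nhds_one (ZMod.toAddCircle j)).const_mul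
      ((1 : DirichletCharacter ℂ q) j))
  refine h2.congr fun s => ?_
  simp only [mul_sub, Finset.sum_sub_distrib, ← Finset.sum_mul]
  rw [prod_one_sub_inv_eq, sub_eq_add_neg (1 : ℂ) s, cpow_add _ _ hq, cpow_one]
  simp only [DirichletCharacter.LFunction, ZMod.LFunction]
  field_simp

lemma LFunction_one_ofReal {x : ℝ} (hx : 1 < x) :
    DirichletCharacter.LFunction (1 : DirichletCharacter ℂ q) x
      = ((∏ p ∈ q.primeFactors, (1 - (p : ℝ) ^ (-x)) : ℝ) : ℂ) * riemannZeta x := by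
  have h1 := DirichletCharacter.LFunctionTrivChar_eq_mul_riemannZeta (N := q) (s := x)
    (by exact_mod_cast hx.ne')
  rw [DirichletCharacter.LFunctionTrivChar] at h1
  rw [h1]
  push_cast
  congr 1
  refine Finset.prod_congr rfl fun p _ => ?_
  rw [ofReal_cpow p.cast_nonneg]
  simp

lemma tendsto_one_sub_natCast_cpow_div (q : ℕ) [NeZero q] :
    Tendsto (fun s : ℂ => (1 - (q : ℂ) ^ (1 - s)) / (s - 1)) (𝓝[≠] 1) (𝓝 (Real.log q)) := by
  have hq : (q : ℂ) ≠ 0 := by exact_mod_cast NeZero.ne q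
  have h1 : HasDerivAt (fun s : ℂ => 1 - (q : ℂ) ^ (1 - s)) (Real.log q) 1 := by
    have := (((hasDerivAt_id (1 : ℂ)).const_sub 1).const_cpow (c := (q : ℂ))
      (Or.inl hq)).const_sub 1
    simpa [natCast_log] using this
  have h2 := hasDerivAt_iff_tendsto_slope.1 h1
  refine h2.congr fun s => ?_
  simp [slope_def_field]

lemma LFunction_one_one_ne_zero (hq : 4 ≤ q) :
    DirichletCharacter.LFunction (1 : DirichletCharacter ℂ q) 1 ≠ 0 := by
  set P : ℝ := ∏ p ∈ q.primeFactors, (1 - (p : ℝ)⁻¹) with hP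
  have hp1 : ∀ p ∈ q.primeFactors, 0 < 1 - (p : ℝ)⁻¹ := fun p hp => by
    have : (1 : ℝ) < p := by exact_mod_cast (Nat.prime_of_mem_primeFactors hp).one_lt
    exact sub_pos.2 (inv_lt_one_of_one_lt₀ this)
  have hP0 : 0 < P := Finset.prod_pos hp1
  have hto : Tendsto (fun x : ℝ => (x : ℂ)) (𝓝[>] 1) (𝓝[≠] 1) := by
    refine tendsto_nhdsWithin_iff.2 ⟨?_, ?_⟩
    · exact (continuous_ofReal.tendsto' 1 1 (by simp)).mono_left nhdsWithin_le_nhds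
    · filter_upwards [self_mem_nhdsWithin] with x (hx : 1 < x)
      exact Set.mem_compl_singleton_iff.2 (by exact_mod_cast hx.ne')
  have h1 := (continuous_re.tendsto _).comp
    (((tendsto_LFunction_one_sub q).mono_left nhdsWithin_le_nhds).comp hto)
  have h2 := (continuous_re.tendsto _).comp
    (((ZetaAsymptotics.tendsto_riemannZeta_sub_one_div_Gammaℝ.add
    ((tendsto_one_sub_natCast_cpow_div q).mul
      ((differentiable_Gammaℝ_inv 1).continuousAt.tendsto.mono_left nhdsWithin_le_nhds))).const_mul
        (P : ℂ)).comp hto)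
  have hle := le_of_tendsto_of_tendsto h2 h1 (by
    filter_upwards [self_mem_nhdsWithin] with x (hx : 1 < x)
    have hx1 : (x : ℂ) - 1 ≠ 0 := sub_ne_zero.2 (by exact_mod_cast hx.ne')
    simp only [Function.comp_apply]
    rw [LFunction_one_ofReal hx]
    have hPP : P ≤ ∏ p ∈ q.primeFactors, (1 - (p : ℝ) ^ (-x)) := by
      refine Finset.prod_le_prod (fun p hp => (hp1 p hp).le) fun p hp => ?_
      have : (1 : ℝ) ≤ p := by exact_mod_cast (Nat.prime_of_mem_primeFactors hp).one_le
      rw [← Real.rpow_neg_one]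
      gcongr
    have hPc : ∏ p ∈ q.primeFactors, (1 - (p : ℂ)⁻¹) = (P : ℂ) := by
      rw [hP]
      push_cast
      rfl
    rw [hPc, ← sub_nonneg, ← sub_re]
    have heq : ((∏ p ∈ q.primeFactors, (1 - (p : ℝ) ^ (-x)) : ℝ) : ℂ) * riemannZeta x
        - (q : ℂ) ^ (1 - (x : ℂ)) * P * (1 / (x - 1) / Gammaℝ x)
        - P * (riemannZeta x - 1 / Gammaℝ x / (x - 1)
          + (1 - (q : ℂ) ^ (1 - (x : ℂ))) / (x - 1) * (Gammaℝ x)⁻¹)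
        = ((∏ p ∈ q.primeFactors, (1 - (p : ℝ) ^ (-x)) - P : ℝ) : ℂ) * riemannZeta x := by
      push_cast
      field_simp
      ring
    rw [heq, re_ofReal_mul]
    exact mul_nonneg (sub_nonneg.2 hPP) (riemannZeta_re_pos_of_one_lt hx).le)
  intro h0
  rw [h0, zero_re] at hle
  have hval : (P * ((Real.eulerMascheroniConstant - Complex.log (4 * Real.pi)) / 2
      + Real.log q * (Gammaℝ 1)⁻¹)).re
      = P * ((Real.eulerMascheroniConstant - Real.log (4 * Real.pi)) / 2 + Real.log q) := by
    rw [Gammaℝ_one, ← ofReal_re (P * ((Real.eulerMascheroniConstant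
      - Real.log (4 * Real.pi)) / 2 + Real.log q))]
    push_cast
    rw [ofReal_log (by positivity : 0 ≤ 4 * Real.pi)]
    simp
  rw [hval] at hle
  have h3 : Real.log (4 * Real.pi) < 2 * Real.log q := by
    have hq4 : (4 : ℝ) ≤ q := by exact_mod_cast hq
    rw [← Real.log_rpow (by linarith)]
    refine Real.log_lt_log (by positivity) ?_
    have := Real.pi_lt_four
    norm_num
    nlinarith
  have h4 := Real.one_half_lt_eulerMascheroniConstant
  have h5 : 0 < P * ((Real.eulerMascheroniConstant - Real.log (4 * Real.pi)) / 2 + Real.log q) :=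
    mul_pos hP0 (by linarith)
  linarith

end Principal

section ZeroFree

open Complex

variable {q : ℕ} [NeZero q]

lemma entireL_eq_zero {χ : DirichletCharacter ℂ q} {s : ℂ} (hs : s ≠ 1) (h : χ.LFunction s = 0) :
    entireL χ s = 0 := by
  by_cases hχ : χ = 1
  · subst hχ
    rw [entireL_one hs, h, mul_zero]
  · rw [entireL_of_ne_one hχ, h]

lemma logConductor_two_mul_le {q : ℕ} (hq : 2 ≤ q) (t : ℝ) :
    logConductor q (2 * t) ≤ 1 + logConductor q t := by
  have hq0 : (2 : ℝ) ≤ q := by exact_mod_cast hq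
  have ht := abs_nonneg t
  have h2 : Real.log 2 ≤ 1 := by linarith [Real.log_two_lt_d9]
  unfold logConductor
  rw [abs_mul, abs_two]
  calc Real.log (q * (2 + 2 * |t|)) ≤ Real.log (2 * (q * (2 + |t|))) := by
        refine Real.log_le_log (by positivity) ?_
        nlinarith
    _ = Real.log 2 + Real.log (q * (2 + |t|)) := Real.log_mul (by norm_num) (by positivity)
    _ ≤ _ := by linarith

lemma logConductor_zero_le {q : ℕ} (hq : 0 < q) (t : ℝ) : logConductor q 0 ≤ logConductor q t := by
  have hq0 : (0 : ℝ) < q := by exact_mod_cast hq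
  unfold logConductor
  refine Real.log_le_log (by simp; positivity) ?_
  simp only [abs_zero, add_zero]
  have ht := abs_nonneg t
  nlinarith

lemma re_one_div_ofReal_add_mul_I (x y : ℝ) :
    (1 / ((x : ℂ) + y * I)).re = x / (x ^ 2 + y ^ 2) := by
  rw [one_div, inv_re, normSq_add_mul_I]
  simp

lemma div_sq_add_sq_le_one_div {x y m : ℝ} (hm : 0 < m) (hy : m ≤ |y|) :
    x / (x ^ 2 + y ^ 2) ≤ 1 / m := by
  have hy2 : m ^ 2 ≤ y ^ 2 := by
    rw [← sq_abs y]
    gcongr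
  rw [div_le_div_iff₀ (by nlinarith) hm]
  nlinarith [sq_nonneg (x - m)]

/-- The parameters used for the zeros of imaginary part `t`: the real part `1 + d` of the points at
which logarithmic derivatives are compared, and a bound `l` for the logarithmic conductor. -/
structure Admissible (q : ℕ) (t d l : ℝ) : Prop where
  conductor_le : logConductor q t ≤ l
  exp_le : Real.exp (-l) ≤ d
  mul_le : 10000 * l * d ≤ 1
  le_l : 20000 ≤ l

namespace Admissible

variable {q : ℕ} {t d l : ℝ}

lemma d_pos (h : Admissible q t d l) : 0 < d := (Real.exp_pos _).trans_le h.exp_le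

lemma l_le (h : Admissible q t d l) : 10000 * l ≤ 1 / d := by
  rw [le_div_iff₀ h.d_pos]
  exact h.mul_le

lemma d_le (h : Admissible q t d l) : d ≤ 1 / 1000 := by
  have := h.mul_le
  have := h.le_l
  nlinarith [h.d_pos]

lemma zero (hq : 0 < q) (h : Admissible q t d l) : Admissible q 0 d l :=
  { h with conductor_le := (logConductor_zero_le hq t).trans h.conductor_le }

end Admissible

lemma re_lt_one_of_LFunction_eq_zero {χ : DirichletCharacter ℂ q} {s : ℂ} (hs : s ≠ 1)
    (h : χ.LFunction s = 0) : s.re < 1 := by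
  by_contra! h1
  exact DirichletCharacter.LFunction_ne_zero_of_one_le_re χ (.inr hs) h1 h

/-- The three-four-one inequality applied to a zero: the character is real, and the zero is close
to the real axis. -/
lemma isReal_of_LFunction_eq_zero (hq : 4 ≤ q) {r : ℝ}
    (hr : ∀ s : ℂ, s ≠ 1 → ‖s - 1‖ < r →
      DirichletCharacter.LFunction (1 : DirichletCharacter ℂ q) s ≠ 0)
    {χ : DirichletCharacter ℂ q} {ρ : ℂ} {d l : ℝ} (h : Admissible q ρ.im d l)
    (hdr : 100 * d ≤ r) (hρ : χ.LFunction ρ = 0) (hρ1 : ρ ≠ 1) (hβ : 1 - d / 49 ≤ ρ.re) :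
    χ ≠ 1 ∧ χ ^ 2 = 1 ∧ |ρ.im| < d / 2 := by
  have hd := h.d_pos
  have hl := h.le_l
  have hlX := h.l_le
  have hd1 := h.d_le
  have hβ1 := re_lt_one_of_LFunction_eq_zero hρ1 hρ
  have hq2 : 2 ≤ q := by omega
  have hσ : 1 < 1 + d := by linarith
  have h341 := three_four_one χ hσ ρ.im
  have hA := re_neg_logDeriv_LFunction_le hq2 (1 : DirichletCharacter ℂ q)
    (s := ((1 + d : ℝ) : ℂ)) (l := l) (by simpa using (h.zero (by omega)).conductor_le)
    (by simpa using h.exp_le) (by simp; linarith)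
  have hB := re_neg_logDeriv_LFunction_le_of_zero hq2 χ (s := ((1 + d : ℝ) : ℂ) + ρ.im * I)
    (ρ := ρ) (l := l) (by simpa using h.conductor_le)
    (by simpa using h.exp_le) (by simp; linarith) (entireL_eq_zero hρ1 hρ) (by
      have : ((1 + d : ℝ) : ℂ) + ρ.im * I - ρ = ((1 + d - ρ.re : ℝ) : ℂ) := by
        apply Complex.ext <;> simp
      rw [this, norm_real, Real.norm_eq_abs, abs_of_pos (by linarith)]
      linarith)
  have hC := re_neg_logDeriv_LFunction_le hq2 (χ ^ 2)
    (s := ((1 + d : ℝ) : ℂ) + (2 * ρ.im : ℝ) * I) (l := 2 * l)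
    (by
      have h1 := logConductor_two_mul_le hq2 ρ.im
      have h2 := h.conductor_le
      have : logConductor q (2 * ρ.im) ≤ 2 * l := by linarith
      simpa using this)
    (by
      have : Real.exp (-(2 * l)) ≤ Real.exp (-l) := Real.exp_le_exp.2 (by linarith)
      simpa using this.trans h.exp_le)
    (by simp; linarith)
  have hz : ((1 + d : ℝ) : ℂ) + ρ.im * I - ρ = ((1 + d - ρ.re : ℝ) : ℂ) := by
    apply Complex.ext <;> simp
  have hz1 : 49 / 50 * (1 / d) ≤ (1 / (((1 + d : ℝ) : ℂ) + ρ.im * I - ρ)).re := by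
    rw [hz, ← ofReal_one, ← ofReal_div, ofReal_re, mul_one_div,
      div_le_div_iff₀ hd (by linarith)]
    nlinarith
  have hp1 : polarPart (1 : DirichletCharacter ℂ q) ((1 + d : ℝ) : ℂ) = 1 / d := by
    rw [polarPart, if_pos rfl]
    have : ((1 + d : ℝ) : ℂ) - 1 = (d : ℂ) := by push_cast; ring
    rw [this, ← ofReal_one, ← ofReal_div, ofReal_re]
  have hs (y : ℝ) : ((1 + d : ℝ) : ℂ) + y * I - 1 = d + y * I := by push_cast; ring
  rw [hp1] at hA
  have hX : 0 < 1 / d := by positivity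
  have hχ : χ ≠ 1 := by
    rintro rfl
    have hγ : r / 2 ≤ |ρ.im| := by
      by_contra! hlt
      refine hr ρ hρ1 ?_ hρ
      have h1 := norm_le_abs_re_add_abs_im (ρ - 1)
      have h2 : |(ρ - 1).re| ≤ d / 49 := by
        rw [abs_le]
        constructor <;> simp <;> linarith
      have h3 : |(ρ - 1).im| = |ρ.im| := by simp
      linarith
    have hm : 50 * d ≤ |ρ.im| := by linarith
    have hp2 : polarPart (1 : DirichletCharacter ℂ q) (((1 + d : ℝ) : ℂ) + ρ.im * I)
        ≤ 1 / (50 * d) := by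
      rw [polarPart, if_pos rfl, hs, re_one_div_ofReal_add_mul_I]
      exact div_sq_add_sq_le_one_div (by positivity) hm
    have hp3 : polarPart ((1 : DirichletCharacter ℂ q) ^ 2)
        (((1 + d : ℝ) : ℂ) + (2 * ρ.im : ℝ) * I) ≤ 1 / (50 * d) := by
      rw [polarPart, if_pos (one_pow 2), hs, re_one_div_ofReal_add_mul_I]
      refine div_sq_add_sq_le_one_div (by positivity) ?_
      rw [abs_mul, abs_two]
      linarith
    have : 1 / (50 * d) = 1 / 50 * (1 / d) := by field_simp
    linarith
  have hp2 : polarPart χ (((1 + d : ℝ) : ℂ) + ρ.im * I) = 0 := by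
    rw [polarPart, if_neg hχ]
  have hχ2 : χ ^ 2 = 1 := by
    by_contra hne
    have hp3 : polarPart (χ ^ 2) (((1 + d : ℝ) : ℂ) + (2 * ρ.im : ℝ) * I) = 0 := by
      rw [polarPart, if_neg hne]
    linarith
  refine ⟨hχ, hχ2, ?_⟩
  by_contra! hγ
  have hp3 : polarPart (χ ^ 2) (((1 + d : ℝ) : ℂ) + (2 * ρ.im : ℝ) * I) ≤ 1 / 2 * (1 / d) := by
    rw [polarPart, if_pos hχ2, hs, re_one_div_ofReal_add_mul_I]
    have : d ^ 2 ≤ (2 * ρ.im) ^ 2 := by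
      rw [← sq_abs (2 * ρ.im), abs_mul, abs_two]
      gcongr
      linarith
    calc d / (d ^ 2 + (2 * ρ.im) ^ 2) ≤ d / (2 * d ^ 2) := by gcongr; linarith
      _ = 1 / 2 * (1 / d) := by field_simp
  linarith

/-- A nonprincipal character cannot have two zeros near `1`. -/
lemma false_of_two_zeros (hq : 2 ≤ q) {χ : DirichletCharacter ℂ q} (hχ : χ ≠ 1) {d l : ℝ}
    (h : Admissible q 0 d l) {ρ₁ ρ₂ : ℂ} (h₁ : χ.LFunction ρ₁ = 0) (h₂ : χ.LFunction ρ₂ = 0)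
    (h₁₂ : ρ₁ = ρ₂ → deriv χ.LFunction ρ₁ = 0) (hβ₁ : ρ₁.re < 1) (hβ₂ : ρ₂.re < 1)
    (hβ₁' : 1 - d / 49 ≤ ρ₁.re) (hβ₂' : 1 - d / 49 ≤ ρ₂.re)
    (hγ₁ : |ρ₁.im| < d / 2) (hγ₂ : |ρ₂.im| < d / 2) : False := by
  have hd := h.d_pos
  have hl := h.le_l
  have hlX := h.l_le
  have hd1 := h.d_le
  have h11 := one_one χ (show 1 < 1 + d by linarith)
  have hA := re_neg_logDeriv_LFunction_le hq (1 : DirichletCharacter ℂ q)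
    (s := ((1 + d : ℝ) : ℂ)) (l := l) (by simpa using h.conductor_le)
    (by simpa using h.exp_le) (by simp; linarith)
  have key (ρ : ℂ) (hβ : ρ.re < 1) (hβ' : 1 - d / 49 ≤ ρ.re) (hγ : |ρ.im| < d / 2) :
      ‖((1 + d : ℝ) : ℂ) - ρ‖ < 1 / 4 ∧ 7 / 10 * (1 / d) ≤ (1 / (((1 + d : ℝ) : ℂ) - ρ)).re := by
    have hz : ((1 + d : ℝ) : ℂ) - ρ = ((1 + d - ρ.re : ℝ) : ℂ) + (-ρ.im : ℝ) * I := by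
      apply Complex.ext <;> simp
    constructor
    · have h1 := norm_le_abs_re_add_abs_im (((1 + d : ℝ) : ℂ) - ρ)
      have h2 : |(((1 + d : ℝ) : ℂ) - ρ).re| ≤ 2 * d := by
        rw [abs_le]
        constructor <;> simp <;> linarith
      have h3 : |(((1 + d : ℝ) : ℂ) - ρ).im| = |ρ.im| := by simp
      linarith
    · rw [hz, re_one_div_ofReal_add_mul_I, mul_one_div, div_le_div_iff₀ hd (by nlinarith)]
      obtain ⟨hγ1, hγ2⟩ := abs_lt.1 hγ
      have e1 : (-ρ.im) ^ 2 ≤ (d / 2) ^ 2 := by nlinarith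
      have e2 : (1 + d - ρ.re) ^ 2 ≤ (1 + d - ρ.re) * (50 / 49 * d) := by
        rw [sq]
        gcongr <;> linarith
      nlinarith
  obtain ⟨hn₁, hr₁⟩ := key ρ₁ hβ₁ hβ₁' hγ₁
  obtain ⟨hn₂, hr₂⟩ := key ρ₂ hβ₂ hβ₂' hγ₂
  have hB := re_neg_logDeriv_LFunction_le_of_two_zeros hq χ
    (s := ((1 + d : ℝ) : ℂ)) (ρ₁ := ρ₁) (ρ₂ := ρ₂) (l := l) (by simpa using h.conductor_le)
    (by simpa using h.exp_le) (by simp; linarith) (by rwa [entireL_of_ne_one hχ])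
    (by rwa [entireL_of_ne_one hχ]) (by rwa [entireL_of_ne_one hχ]) hn₁ hn₂
  have hp1 : polarPart (1 : DirichletCharacter ℂ q) ((1 + d : ℝ) : ℂ) = 1 / d := by
    rw [polarPart, if_pos rfl]
    have : ((1 + d : ℝ) : ℂ) - 1 = (d : ℂ) := by push_cast; ring
    rw [this, ← ofReal_one, ← ofReal_div, ofReal_re]
  have hp2 : polarPart χ ((1 + d : ℝ) : ℂ) = 0 := by
    rw [polarPart, if_neg hχ]
  have hX : 0 < 1 / d := by positivity
  rw [hp1] at hA
  linarith

end ZeroFree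

section Uniqueness

open Complex ComplexConjugate

variable {q : ℕ} [NeZero q]

lemma DirichletCharacter.isReal_of_sq_eq_one {q : ℕ} {χ : DirichletCharacter ℂ q}
    (h : χ ^ 2 = 1) : χ.IsReal := by
  intro a
  by_cases ha : IsUnit a
  · have h1 : (χ a) ^ 2 = 1 := by
      rw [← MulChar.pow_apply' χ two_ne_zero, h, MulChar.one_apply ha]
    rcases sq_eq_sq_iff_eq_or_eq_neg.1 (h1.trans (one_pow 2).symm) with h2 | h2 <;> simp [h2]
  · simp [MulChar.map_nonunit χ ha]

lemma LFunction_conj_of_one_lt_re {χ : DirichletCharacter ℂ q} (h : χ.IsReal) {s : ℂ}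
    (hs : 1 < s.re) : conj (χ.LFunction (conj s)) = χ.LFunction s := by
  rw [χ.LFunction_eq_LSeries (by rwa [conj_re]), χ.LFunction_eq_LSeries hs, LSeries, LSeries,
    conj_tsum]
  refine tsum_congr fun n => ?_
  rcases eq_or_ne n 0 with rfl | hn
  · simp
  · rw [LSeries.term_of_ne_zero hn, LSeries.term_of_ne_zero hn, map_div₀, ← h,
      ← conj_cpow _ _ (by rw [natCast_arg]; positivity), conj_natCast]

lemma LFunction_conj {χ : DirichletCharacter ℂ q} (hχ : χ ≠ 1) (h : χ.IsReal) {s : ℂ}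
    (hs : 0 < s.re) : χ.LFunction s = conj (χ.LFunction (conj s)) :=
  eqOn_re_pos_of_eqOn_one_lt_re (χ.differentiable_LFunction hχ)
    (g := fun z => conj (χ.LFunction (conj z)))
    (fun _ _ => differentiableAt_conj_conj_iff.2 (χ.differentiable_LFunction hχ _))
    (fun _ hz => (LFunction_conj_of_one_lt_re h hz).symm) hs

/-- Two distinct real nonprincipal characters cannot both have a real zero near `1`. -/
lemma false_of_zeros_of_ne (hq : 2 ≤ q) {χ₁ χ₂ : DirichletCharacter ℂ q} (hχ₁ : χ₁ ≠ 1)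
    (hχ₂ : χ₂ ≠ 1) (hsq : χ₁ ^ 2 = 1) (hne : χ₁ ≠ χ₂) {d l : ℝ}
    (h : Admissible q 0 d l) {β₁ β₂ : ℝ} (h₁ : χ₁.LFunction β₁ = 0) (h₂ : χ₂.LFunction β₂ = 0)
    (hβ₁ : β₁ < 1) (hβ₂ : β₂ < 1) (hβ₁' : 1 - d / 49 ≤ β₁) (hβ₂' : 1 - d / 49 ≤ β₂) : False := by
  have hd := h.d_pos
  have hl := h.le_l
  have hlX := h.l_le
  have hd1 := h.d_le
  have hχ₁₂ : χ₁ * χ₂ ≠ 1 := by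
    intro h12
    exact hne (mul_left_cancel (a := χ₁) (by rw [h12, ← sq, hsq]))
  have h11 := one_one_one_one (χ₂ := χ₂) (DirichletCharacter.isReal_of_sq_eq_one hsq)
    (show 1 < 1 + d by linarith)
  have hA (χ : DirichletCharacter ℂ q) := re_neg_logDeriv_LFunction_le hq χ
    (s := ((1 + d : ℝ) : ℂ)) (l := l) (by simpa using h.conductor_le)
    (by simpa using h.exp_le) (by simp; linarith)
  have key {χ : DirichletCharacter ℂ q} (hχ : χ ≠ 1) {β : ℝ} (h0 : χ.LFunction β = 0) (hβ : β < 1)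
      (hβ' : 1 - d / 49 ≤ β) :
      (-logDeriv χ.LFunction ((1 + d : ℝ) : ℂ)).re ≤ 112 * l + 4 - 49 / 50 * (1 / d) := by
    have hz : ((1 + d : ℝ) : ℂ) - β = ((1 + d - β : ℝ) : ℂ) := by push_cast; ring
    have hB := re_neg_logDeriv_LFunction_le_of_zero hq χ (s := ((1 + d : ℝ) : ℂ))
      (ρ := β) (l := l) (by simpa using h.conductor_le)
      (by simpa using h.exp_le) (by simp; linarith) (by rwa [entireL_of_ne_one hχ]) (by
        rw [hz, norm_real, Real.norm_eq_abs, abs_of_pos (by linarith)]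
        linarith)
    have hz1 : 49 / 50 * (1 / d) ≤ (1 / (((1 + d : ℝ) : ℂ) - β)).re := by
      rw [hz, ← ofReal_one, ← ofReal_div, ofReal_re, mul_one_div,
        div_le_div_iff₀ hd (by linarith)]
      nlinarith
    rw [polarPart, if_neg hχ] at hB
    linarith
  have hp1 : polarPart (1 : DirichletCharacter ℂ q) ((1 + d : ℝ) : ℂ) = 1 / d := by
    rw [polarPart, if_pos rfl]
    have : ((1 + d : ℝ) : ℂ) - 1 = (d : ℂ) := by push_cast; ring
    rw [this, ← ofReal_one, ← ofReal_div, ofReal_re]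
  have hp2 : polarPart (χ₁ * χ₂) ((1 + d : ℝ) : ℂ) = 0 := by
    rw [polarPart, if_neg hχ₁₂]
  have hX : 0 < 1 / d := by positivity
  have h3 := hA 1
  have h4 := hA (χ₁ * χ₂)
  have h5 := key hχ₁ h₁ hβ₁ hβ₁'
  have h6 := key hχ₂ h₂ hβ₂ hβ₂'
  rw [hp1] at h3
  linarith

lemma im_eq_zero_of_LFunction_eq_zero (hq : 2 ≤ q) {χ : DirichletCharacter ℂ q} (hχ : χ ≠ 1)
    (hsq : χ ^ 2 = 1) {d l : ℝ} (h : Admissible q 0 d l) {ρ : ℂ} (hρ : χ.LFunction ρ = 0)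
    (hβ : ρ.re < 1) (hβ' : 1 - d / 49 ≤ ρ.re) (hγ : |ρ.im| < d / 2) : ρ.im = 0 := by
  by_contra hne
  have hd1 := h.d_le
  have hconj : χ.LFunction (conj ρ) = 0 := by
    have := LFunction_conj hχ (DirichletCharacter.isReal_of_sq_eq_one hsq) (s := conj ρ)
      (by rw [conj_re]; linarith)
    rw [this, conj_conj, hρ, map_zero]
  refine false_of_two_zeros hq hχ h hρ hconj (fun heq => (hne ?_).elim) hβ (by rwa [conj_re])
    hβ' (by rwa [conj_re]) hγ (by rwa [conj_im, abs_neg])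
  exact conj_eq_iff_im.1 heq.symm

lemma analyticAt_LFunction (χ : DirichletCharacter ℂ q) {s : ℂ} (hs : s ≠ 1) :
    AnalyticAt ℂ χ.LFunction s :=
  DifferentiableOn.analyticAt (s := {1}ᶜ)
    (fun z hz => (χ.differentiableAt_LFunction z (.inl hz)).differentiableWithinAt)
    (isOpen_compl_singleton.mem_nhds hs)

lemma LProd_eq_zero_iff {s : ℂ} :
    LProd q s = 0 ↔ ∃ χ : DirichletCharacter ℂ q, χ.LFunction s = 0 := by
  simp [LProd, Finset.prod_eq_zero_iff]

lemma analyticZeroOrder_LProd_eq_one {χ : DirichletCharacter ℂ q} {s : ℂ} (hs : s ≠ 1)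
    (h0 : χ.LFunction s = 0) (h1 : deriv χ.LFunction s ≠ 0)
    (h : ∀ χ' : DirichletCharacter ℂ q, χ' ≠ χ → χ'.LFunction s ≠ 0) :
    analyticZeroOrder (LProd q) s = 1 := by
  have hrest : AnalyticAt ℂ (fun z => ∏ χ' ∈ Finset.univ.erase χ, χ'.LFunction z) s :=
    Finset.analyticAt_fun_prod _ fun χ' _ => analyticAt_LFunction χ' hs
  have hmul : LProd q = χ.LFunction * fun z => ∏ χ' ∈ Finset.univ.erase χ, χ'.LFunction z := by
    funext z
    exact (Finset.mul_prod_erase _ (fun χ' : DirichletCharacter ℂ q => χ'.LFunction z)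
      (Finset.mem_univ χ)).symm
  have hχ := analyticAt_LFunction χ hs
  have hone : analyticOrderAt χ.LFunction s = 1 := by
    simpa [h0] using hχ.analyticOrderAt_sub_eq_one_of_deriv_ne_zero h1
  have hzero : analyticOrderAt (fun z => ∏ χ' ∈ Finset.univ.erase χ, χ'.LFunction z) s = 0 :=
    hrest.analyticOrderAt_eq_zero.2
      (Finset.prod_ne_zero_iff.2 fun χ' hχ' => h χ' (Finset.ne_of_mem_erase hχ'))
  rw [analyticZeroOrder, hmul, dif_pos (hχ.mul hrest), analyticOrderAt_mul hχ hrest, hone, hzero,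
    add_zero]

lemma admissible_of_two_le {q : ℕ} {δ : ℝ} (hδ : 0 < δ) (hδ' : δ ≤ 1 / 10000) {t : ℝ}
    (h : 2 / δ ≤ logConductor q t) :
    Admissible q t (δ / logConductor q t) (logConductor q t) := by
  set l := logConductor q t
  have h1 : 2 ≤ l * δ := by rwa [div_le_iff₀ hδ] at h
  have hl : 20000 ≤ l := by nlinarith
  refine ⟨le_rfl, ?_, ?_, hl⟩
  · have := Real.quadratic_le_exp_of_nonneg (x := l) (by linarith)
    rw [Real.exp_neg, inv_le_comm₀ (Real.exp_pos _) (by positivity), inv_div,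
      div_le_iff₀ hδ]
    nlinarith
  · have : 10000 * l * (δ / l) = 10000 * δ := by field_simp
    linarith

end Uniqueness

/-- **Zero-free region**: there are `c₁ > 0` and `q₀` such that for every `q ≥ q₀` the product
`∏_{χ mod q} L(s,χ)` has at most one zero `s = σ + it` with `σ ≥ 1 - c₁/log(q(2+|t|))`; such a
zero, if it exists, is real, is a simple zero, and is a zero of `L(s,χ)` for some nonprincipal
real character `χ` mod `q`. -/
theorem zero_free_region :
    ∃ c₁ : ℝ, 0 < c₁ ∧ ∃ q₀ : ℕ, ∀ (q : ℕ) [NeZero q], q₀ ≤ q →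
      ((∀ ρ₁ ρ₂ : ℂ,
        (LProd q ρ₁ = 0 ∧ 1 - c₁ / Real.log (q * (2 + |ρ₁.im|)) ≤ ρ₁.re) →
        (LProd q ρ₂ = 0 ∧ 1 - c₁ / Real.log (q * (2 + |ρ₂.im|)) ≤ ρ₂.re) → ρ₁ = ρ₂) ∧
      (∀ ρ : ℂ, LProd q ρ = 0 → 1 - c₁ / Real.log (q * (2 + |ρ.im|)) ≤ ρ.re →
        ρ.im = 0 ∧ analyticZeroOrder (LProd q) ρ = 1 ∧
        ∃ χ : DirichletCharacter ℂ q, χ ≠ 1 ∧ χ.IsReal ∧ χ.LFunction ρ = 0)) := by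
  obtain ⟨r, hr0, -, hr⟩ := exists_LFunction_one_ne_zero
  obtain ⟨δ, hδ, hδ1, hδr⟩ : ∃ δ : ℝ, 0 < δ ∧ δ ≤ 1 / 10000 ∧ δ ≤ r :=
    ⟨min (1 / 10000) r, by positivity, min_le_left _ _, min_le_right _ _⟩
  refine ⟨δ / 49, by positivity, ⌈Real.exp (2 / δ)⌉₊ + 4, fun q _ hq => ?_⟩
  have hq4 : 4 ≤ q := by omega
  have hq2 : 2 ≤ q := by omega
  have hlog : 2 / δ ≤ logConductor q 0 := by
    have h1 : Real.exp (2 / δ) ≤ q :=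
      (Nat.le_ceil _).trans (by exact_mod_cast (Nat.le_add_right _ 4).trans hq)
    rw [logConductor, Real.le_log_iff_exp_le (by positivity)]
    simp only [abs_zero, add_zero]
    linarith [Real.exp_pos (2 / δ)]
  have hlt (t : ℝ) : 2 / δ ≤ logConductor q t := hlog.trans (logConductor_zero_le (by omega) t)
  have hadm (t : ℝ) := admissible_of_two_le hδ hδ1 (hlt t)
  have hreg (ρ : ℂ) (hβ : 1 - δ / 49 / Real.log (q * (2 + |ρ.im|)) ≤ ρ.re) :
      1 - δ / logConductor q ρ.im / 49 ≤ ρ.re := by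
    rwa [div_right_comm]
  have hone (χ : DirichletCharacter ℂ q) {ρ : ℂ} (hρ : χ.LFunction ρ = 0) : ρ ≠ 1 := by
    rintro rfl
    by_cases hχ : χ = 1
    · exact LFunction_one_one_ne_zero hq4 (hχ ▸ hρ)
    · exact DirichletCharacter.LFunction_ne_zero_of_one_le_re χ (.inl hχ) le_rfl hρ
  have hreal (χ : DirichletCharacter ℂ q) (ρ : ℂ) (hρ : χ.LFunction ρ = 0)
      (hβ : 1 - δ / 49 / Real.log (q * (2 + |ρ.im|)) ≤ ρ.re) :
      χ ≠ 1 ∧ χ ^ 2 = 1 ∧ ρ.im = 0 := by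
    have hρ1 := hone χ hρ
    have hA := hadm ρ.im
    obtain ⟨h1, h2, h3⟩ := isReal_of_LFunction_eq_zero hq4 (hr q) hA (by
      have h4 : δ / logConductor q ρ.im ≤ δ / 20000 := by
        gcongr
        exact hA.le_l
      linarith) hρ hρ1 (hreg ρ hβ)
    exact ⟨h1, h2, im_eq_zero_of_LFunction_eq_zero hq2 h1 h2 (hA.zero (by omega)) hρ
      (re_lt_one_of_LFunction_eq_zero hρ1 hρ) (hreg ρ hβ) h3⟩
  have hA := hadm 0
  have hd := hA.d_pos
  have hchar (χ₁ χ₂ : DirichletCharacter ℂ q) (ρ₁ ρ₂ : ℂ) (h₁ : χ₁.LFunction ρ₁ = 0)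
      (h₂ : χ₂.LFunction ρ₂ = 0) (hβ₁ : 1 - δ / 49 / Real.log (q * (2 + |ρ₁.im|)) ≤ ρ₁.re)
      (hβ₂ : 1 - δ / 49 / Real.log (q * (2 + |ρ₂.im|)) ≤ ρ₂.re) : χ₁ = χ₂ := by
    by_contra hne
    obtain ⟨hχ₁, hsq, hγ₁⟩ := hreal χ₁ ρ₁ h₁ hβ₁
    obtain ⟨hχ₂, -, hγ₂⟩ := hreal χ₂ ρ₂ h₂ hβ₂
    have e₁ : ((ρ₁.re : ℝ) : ℂ) = ρ₁ := Complex.ext (by simp) (by simp [hγ₁])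
    have e₂ : ((ρ₂.re : ℝ) : ℂ) = ρ₂ := Complex.ext (by simp) (by simp [hγ₂])
    refine false_of_zeros_of_ne hq2 hχ₁ hχ₂ hsq hne hA (by rwa [e₁]) (by rwa [e₂])
      (re_lt_one_of_LFunction_eq_zero (hone _ h₁) h₁)
      (re_lt_one_of_LFunction_eq_zero (hone _ h₂) h₂) ?_ ?_
    · simpa [hγ₁] using hreg ρ₁ hβ₁
    · simpa [hγ₂] using hreg ρ₂ hβ₂
  have htwo (χ : DirichletCharacter ℂ q) (ρ₁ ρ₂ : ℂ) (h₁ : χ.LFunction ρ₁ = 0)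
      (h₂ : χ.LFunction ρ₂ = 0) (hβ₁ : 1 - δ / 49 / Real.log (q * (2 + |ρ₁.im|)) ≤ ρ₁.re)
      (hβ₂ : 1 - δ / 49 / Real.log (q * (2 + |ρ₂.im|)) ≤ ρ₂.re)
      (h₁₂ : ρ₁ = ρ₂ → deriv χ.LFunction ρ₁ = 0) : False := by
    obtain ⟨hχ, -, hγ₁⟩ := hreal χ ρ₁ h₁ hβ₁
    obtain ⟨-, -, hγ₂⟩ := hreal χ ρ₂ h₂ hβ₂
    refine false_of_two_zeros hq2 hχ hA h₁ h₂ h₁₂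
      (re_lt_one_of_LFunction_eq_zero (hone _ h₁) h₁)
      (re_lt_one_of_LFunction_eq_zero (hone _ h₂) h₂) ?_ ?_
      (by rw [hγ₁, abs_zero]; positivity) (by rw [hγ₂, abs_zero]; positivity)
    · simpa [hγ₁] using hreg ρ₁ hβ₁
    · simpa [hγ₂] using hreg ρ₂ hβ₂
  refine ⟨fun ρ₁ ρ₂ ⟨h₁, hβ₁⟩ ⟨h₂, hβ₂⟩ => ?_, fun ρ h hβ => ?_⟩
  · obtain ⟨χ₁, h₁⟩ := LProd_eq_zero_iff.1 h₁
    obtain ⟨χ₂, h₂⟩ := LProd_eq_zero_iff.1 h₂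
    obtain rfl := hchar χ₁ χ₂ ρ₁ ρ₂ h₁ h₂ hβ₁ hβ₂
    by_contra hne
    exact htwo χ₁ ρ₁ ρ₂ h₁ h₂ hβ₁ hβ₂ fun h => (hne h).elim
  · obtain ⟨χ, hχ⟩ := LProd_eq_zero_iff.1 h
    obtain ⟨h1, h2, h3⟩ := hreal χ ρ hχ hβ
    refine ⟨h3, analyticZeroOrder_LProd_eq_one (hone χ hχ) hχ
      (fun h0 => htwo χ ρ ρ hχ hχ hβ hβ fun _ => h0) (fun χ' hne h' => ?_),
      χ, h1, DirichletCharacter.isReal_of_sq_eq_one h2, hχ⟩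
    exact hne (hchar χ' χ ρ ρ h' hχ hβ hβ)
end

section
/- Let K > 0 and λ > 0 be real. Define h₁(t) = sinh((K − t)λ) for 0 ≤ t ≤ K and h₁(t) = 0 for t ≥ K; let H₁(z) = ∫_0^∞ e^{−zt} h₁(t) dt and H₂(z) = ((1 − e^{−Kz})/z)². Then for every z ∈ ℂ with Re z ≥ 0: Re H₁(z) ≥ (λ·e^{Kλ}/2)·|H₂(λ + z)|. -/
open scoped Classical

/-- `h₁(t) = sinh((K-t)λ)` for `0 ≤ t ≤ K`, and `0` for `t ≥ K`. -/
noncomputable def h1 (K lam t : ℝ) : ℝ :=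
  if t ≤ K then Real.sinh ((K - t) * lam) else 0

/-- `H₁`, the Laplace transform of `h₁`. -/
noncomputable def H1 (K lam : ℝ) (z : ℂ) : ℂ :=
  ∫ t in Set.Ioi (0 : ℝ), Complex.exp (-z * t) * (h1 K lam t : ℂ)

/-- `H₂(z) = ((1 - e^{-Kz})/z)²`. -/
noncomputable def H2 (K : ℝ) (z : ℂ) : ℂ :=
  ((1 - Complex.exp (-(K : ℂ) * z)) / z) ^ 2

/-- A Phragmén–Lindelöf comparison principle: if `f` and `g` are bounded holomorphic functions on
the right half-plane and `‖f‖ ≤ Re g` on the imaginary axis, then `‖f‖ ≤ Re g` throughout. -/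
theorem norm_le_re_of_norm_le_re_imaginary_axis {f g : ℂ → ℂ} {A B : ℝ}
    (hf : DiffContOnCl ℂ f {z | 0 < z.re}) (hg : DiffContOnCl ℂ g {z | 0 < z.re})
    (hfA : ∀ z : ℂ, 0 ≤ z.re → ‖f z‖ ≤ A) (hgB : ∀ z : ℂ, 0 ≤ z.re → ‖g z‖ ≤ B)
    (him : ∀ y : ℝ, ‖f (y * Complex.I)‖ ≤ (g (y * Complex.I)).re)
    {z : ℂ} (hz : 0 ≤ z.re) : ‖f z‖ ≤ (g z).re := by
  obtain ⟨c, hc, hcz⟩ : ∃ c : ℂ, ‖c‖ ≤ 1 ∧ (c * f z).re = ‖f z‖ := by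
    refine ⟨(starRingEnd ℂ) (f z) / ‖f z‖, ?_, ?_⟩
    · simpa using div_self_le_one ‖f z‖
    · rw [div_mul_eq_mul_div, Complex.conj_mul', ← Complex.ofReal_pow, ← Complex.ofReal_div,
        Complex.ofReal_re, sq, mul_self_div_self]
  have hcf (w : ℂ) : ‖c * f w‖ ≤ ‖f w‖ := by
    rw [norm_mul]
    exact mul_le_of_le_one_left (norm_nonneg _) hc
  have hnorm (w : ℂ) : ‖Complex.exp (c * f w - g w)‖ = Real.exp ((c * f w).re - (g w).re) := by
    rw [Complex.norm_exp, Complex.sub_re]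
  have hbound (w : ℂ) (hw : 0 ≤ w.re) : ‖Complex.exp (c * f w - g w)‖ ≤ Real.exp (A + B) := by
    rw [hnorm, Real.exp_le_exp]
    have h₁ := Complex.re_le_norm (c * f w)
    have h₂ := (abs_le.mp (Complex.abs_re_le_norm (g w))).1
    linarith [hcf w, hfA w hw, hgB w hw]
  have hdiff : DiffContOnCl ℂ (fun w => Complex.exp (c * f w - g w)) {z | 0 < z.re} :=
    Complex.differentiable_exp.comp_diffContOnCl ((hf.const_smul c).sub hg)
  have key := PhragmenLindelof.right_half_plane_of_bounded_on_real (C := 1) hdiff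
    ⟨1, by norm_num, 0, by
      refine Asymptotics.IsBigO.of_bound (Real.exp (A + B)) ?_
      filter_upwards [Filter.mem_inf_of_right (Filter.mem_principal_self _)] with w hw
      simpa using hbound w (le_of_lt hw)⟩
    (Filter.isBoundedUnder_of_eventually_le (a := Real.exp (A + B)) (by
      filter_upwards [Filter.eventually_ge_atTop (0 : ℝ)] with x hx
      exact hbound x (by simpa using hx)))
    (fun y => by
      rw [hnorm, Real.exp_le_one_iff]
      linarith [Complex.re_le_norm (c * f (y * Complex.I)), hcf (y * Complex.I), him y])
    hz
  rw [hnorm, Real.exp_le_one_iff, hcz] at key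
  linarith

theorem differentiable_integral_exp_neg_mul (K : ℝ) :
    Differentiable ℂ fun w : ℂ => ∫ t in (0 : ℝ)..K, Complex.exp (-w * t) := by
  have heq : (fun w : ℂ => ∫ t in (0 : ℝ)..K, Complex.exp (-w * t)) =
      dslope (fun w : ℂ => -Complex.exp (-w * K)) 0 := by
    funext w
    rcases eq_or_ne w 0 with rfl | hw
    · simp [dslope_same]
    · rw [dslope_of_ne _ hw, slope_def_field, integral_exp_mul_complex (neg_ne_zero.mpr hw)]
      simp only [neg_zero, zero_mul, Complex.ofReal_zero, mul_zero, Complex.exp_zero, sub_zero]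
      field_simp
      ring
  rw [heq, ← differentiableOn_univ, Complex.differentiableOn_dslope Filter.univ_mem,
    differentiableOn_univ]
  fun_prop

theorem H1_eq_intervalIntegral {K : ℝ} (hK : 0 < K) (lam : ℝ) (z : ℂ) :
    H1 K lam z =
      ∫ t in (0 : ℝ)..K, Complex.exp (-z * t) * (Real.sinh ((K - t) * lam) : ℂ) := by
  rw [H1, intervalIntegral.integral_of_le hK.le,
    MeasureTheory.setIntegral_eq_of_subset_of_forall_sdiff_eq_zero measurableSet_Ioi
      (s := Set.Ioc 0 K) fun t ht => ht.1]
  · refine MeasureTheory.setIntegral_congr_fun measurableSet_Ioc fun t ht => ?_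
    simp [h1, ht.2]
  · rintro t ⟨ht₀, ht⟩
    have htK : ¬ t ≤ K := fun h => ht ⟨ht₀, h⟩
    simp [h1, htK]

theorem H1_eq_sub {K : ℝ} (hK : 0 < K) (lam : ℝ) (z : ℂ) :
    H1 K lam z =
      Complex.exp (K * lam) / 2 * (∫ t in (0 : ℝ)..K, Complex.exp (-(z + lam) * t)) -
      Complex.exp (-(K * lam)) / 2 * (∫ t in (0 : ℝ)..K, Complex.exp (-(z - lam) * t)) := by
  rw [H1_eq_intervalIntegral hK, ← intervalIntegral.integral_const_mul,
    ← intervalIntegral.integral_const_mul, ← intervalIntegral.integral_sub]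
  · congr 1
    funext t
    have h₁ : Complex.exp (K * lam) * Complex.exp (-(z + lam) * t) =
        Complex.exp (-z * t) * Complex.exp ((K - t) * lam) := by
      rw [← Complex.exp_add, ← Complex.exp_add]
      ring_nf
    have h₂ : Complex.exp (-(K * lam)) * Complex.exp (-(z - lam) * t) =
        Complex.exp (-z * t) * Complex.exp (-((K - t) * lam)) := by
      rw [← Complex.exp_add, ← Complex.exp_add]
      ring_nf
    push_cast
    rw [Complex.sinh]
    linear_combination (h₂ - h₁) / 2
  · exact (by fun_prop : Continuous _).intervalIntegrable _ _
  · exact (by fun_prop : Continuous _).intervalIntegrable _ _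

theorem differentiable_H1 {K : ℝ} (hK : 0 < K) (lam : ℝ) : Differentiable ℂ (H1 K lam) := by
  rw [funext (H1_eq_sub hK lam)]
  have h := differentiable_integral_exp_neg_mul K
  exact ((h.comp (differentiable_id.add_const (lam : ℂ))).const_mul _).sub
    ((h.comp (differentiable_id.sub_const (lam : ℂ))).const_mul _)

theorem norm_H1_le {K lam : ℝ} (hK : 0 < K) (hlam : 0 < lam) {z : ℂ} (hz : 0 ≤ z.re) :
    ‖H1 K lam z‖ ≤ Real.sinh (K * lam) * K := by
  rw [H1_eq_intervalIntegral hK]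
  have h := intervalIntegral.norm_integral_le_of_norm_le_const (a := (0 : ℝ)) (b := K)
    (C := Real.sinh (K * lam))
    (f := fun t : ℝ => Complex.exp (-z * t) * (Real.sinh ((K - t) * lam) : ℂ)) ?_
  · rwa [sub_zero, abs_of_pos hK] at h
  · intro t ht
    rw [Set.uIoc_of_le hK.le] at ht
    have hs : 0 ≤ Real.sinh ((K - t) * lam) :=
      Real.sinh_nonneg_iff.mpr (mul_nonneg (sub_nonneg.mpr ht.2) hlam.le)
    rw [norm_mul, Complex.norm_real, Real.norm_of_nonneg hs, Complex.norm_exp]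
    have he : Real.exp (-z * t).re ≤ 1 := by
      rw [Real.exp_le_one_iff]
      simpa using mul_nonneg hz ht.1.le
    refine (mul_le_of_le_one_left hs he).trans (Real.sinh_le_sinh.mpr ?_)
    exact mul_le_mul_of_nonneg_right (by linarith [ht.1]) hlam.le

theorem H1_eq_div {K : ℝ} (hK : 0 < K) {lam : ℝ} {z : ℂ} (h₁ : z + lam ≠ 0) (h₂ : z - lam ≠ 0) :
    H1 K lam z = (z * Complex.sinh (K * lam) - lam * Complex.cosh (K * lam) +
      lam * Complex.exp (-z * K)) / ((z + lam) * (z - lam)) := by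
  rw [H1_eq_sub hK, integral_exp_mul_complex (neg_ne_zero.mpr h₁),
    integral_exp_mul_complex (neg_ne_zero.mpr h₂), Complex.sinh, Complex.cosh]
  have e₁ : Complex.exp (-(z + lam) * K) = Complex.exp (-z * K) * Complex.exp (-(K * lam)) := by
    rw [← Complex.exp_add]
    ring_nf
  have e₂ : Complex.exp (-(z - lam) * K) = Complex.exp (-z * K) * Complex.exp (K * lam) := by
    rw [← Complex.exp_add]
    ring_nf
  have e₃ : Complex.exp (K * lam) * Complex.exp (-(K * lam)) = 1 := by
    rw [← Complex.exp_add, add_neg_cancel, Complex.exp_zero]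
  rw [e₁, e₂]
  simp only [Complex.ofReal_zero, mul_zero, Complex.exp_zero]
  field_simp
  linear_combination (2 * lam * Complex.exp (-(K * z))) * e₃

theorem re_H1_mul_I {K lam : ℝ} (hK : 0 < K) (hlam : 0 < lam) (y : ℝ) :
    (H1 K lam (y * Complex.I)).re =
      lam * (Real.cosh (K * lam) - Real.cos (y * K)) / (lam ^ 2 + y ^ 2) := by
  have h₁ : (y * Complex.I + lam : ℂ) ≠ 0 := fun h => hlam.ne' (by simpa using congrArg Complex.re h)
  have h₂ : (y * Complex.I - lam : ℂ) ≠ 0 := fun h => hlam.ne' (by simpa using congrArg Complex.re h)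
  have hden : (y * Complex.I + lam : ℂ) * (y * Complex.I - lam) =
      ((-(lam ^ 2 + y ^ 2) : ℝ) : ℂ) := by
    push_cast
    linear_combination (y : ℂ) ^ 2 * Complex.I_sq
  have hexp : Complex.exp (-(y * Complex.I) * K) =
      (Real.cos (y * K) : ℂ) - Real.sin (y * K) * Complex.I := by
    rw [show -(y * Complex.I) * K = ((-(y * K) : ℝ) : ℂ) * Complex.I by push_cast; ring,
      Complex.exp_mul_I, ← Complex.ofReal_cos, ← Complex.ofReal_sin, Real.cos_neg, Real.sin_neg]
    push_cast
    ring
  rw [H1_eq_div hK h₁ h₂, hden, hexp, Complex.div_ofReal_re, ← Complex.ofReal_mul,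
    ← Complex.ofReal_sinh, ← Complex.ofReal_cosh, div_neg, ← neg_div]
  congr 1
  simp only [Complex.add_re, Complex.sub_re, Complex.mul_re, Complex.mul_im, Complex.sub_im,
    Complex.ofReal_re, Complex.ofReal_im, Complex.I_re, Complex.I_im]
  ring

theorem norm_H2_add_mul_I (K lam y : ℝ) :
    ‖H2 K (lam + y * Complex.I)‖ =
      2 * Real.exp (-(K * lam)) * (Real.cosh (K * lam) - Real.cos (y * K)) /
        (lam ^ 2 + y ^ 2) := by
  have hexp : Complex.exp (-(K : ℂ) * (lam + y * Complex.I)) =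
      Real.exp (-(K * lam)) * ((Real.cos (y * K) : ℂ) - Real.sin (y * K) * Complex.I) := by
    rw [show -(K : ℂ) * (lam + y * Complex.I) =
        ((-(K * lam) : ℝ) : ℂ) + ((-(y * K) : ℝ) : ℂ) * Complex.I by push_cast; ring,
      Complex.exp_add, Complex.exp_mul_I, ← Complex.ofReal_cos, ← Complex.ofReal_sin,
      Real.cos_neg, Real.sin_neg, ← Complex.ofReal_exp]
    push_cast
    ring
  have hprod : Real.exp (-(K * lam)) * Real.exp (K * lam) = 1 := by
    rw [← Real.exp_add, neg_add_cancel, Real.exp_zero]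
  rw [H2, norm_pow, norm_div, div_pow, Complex.sq_norm, Complex.sq_norm, hexp,
    Complex.normSq_add_mul_I, Complex.normSq_apply, Real.cosh_eq]
  congr 1
  simp only [Complex.sub_re, Complex.mul_re, Complex.mul_im, Complex.sub_im, Complex.one_re,
    Complex.one_im, Complex.ofReal_re, Complex.ofReal_im, Complex.I_re, Complex.I_im]
  linear_combination Real.exp (-(K * lam)) ^ 2 * Real.sin_sq_add_cos_sq (y * K) - hprod

theorem norm_H2_add_le {K lam : ℝ} (hK : 0 < K) (hlam : 0 < lam) {z : ℂ} (hz : 0 ≤ z.re) :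
    ‖H2 K (lam + z)‖ ≤ (2 / lam) ^ 2 := by
  have hre : lam ≤ ‖(lam + z : ℂ)‖ :=
    le_trans (by simpa using hz) (Complex.re_le_norm (lam + z))
  have hexp : ‖Complex.exp (-(K : ℂ) * (lam + z))‖ ≤ 1 := by
    rw [Complex.norm_exp, Real.exp_le_one_iff]
    simpa using mul_nonneg hK.le (add_nonneg hlam.le hz)
  have hnum : ‖1 - Complex.exp (-(K : ℂ) * (lam + z))‖ ≤ 2 := by
    refine (norm_sub_le _ _).trans ?_
    rw [norm_one]
    linarith
  rw [H2, norm_pow, norm_div]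
  gcongr

theorem diffContOnCl_H2_add (K : ℝ) {lam : ℝ} (hlam : 0 < lam) :
    DiffContOnCl ℂ (fun z => H2 K (lam + z)) {z | 0 < z.re} := by
  refine DifferentiableOn.diffContOnCl fun z hz => DifferentiableAt.differentiableWithinAt ?_
  rw [Complex.closure_setOfPred_lt_re] at hz
  have hne : (lam + z : ℂ) ≠ 0 := fun h => by
    have := congrArg Complex.re h
    have hz' : 0 ≤ z.re := hz
    simp only [Complex.add_re, Complex.ofReal_re, Complex.zero_re] at this
    linarith
  unfold H2
  fun_prop (disch := exact hne)

/-- For `K, λ > 0` and `Re z ≥ 0`, `Re H₁(z) ≥ (λe^{Kλ}/2)·|H₂(λ + z)|`. -/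
theorem re_H1_ge (K lam : ℝ) (hK : 0 < K) (hlam : 0 < lam) :
    ∀ z : ℂ, 0 ≤ z.re →
      (lam * Real.exp (K * lam) / 2) * ‖H2 K ((lam : ℂ) + z)‖
        ≤ (H1 K lam z).re := by
  intro z hz
  have hcoef : 0 ≤ lam * Real.exp (K * lam) / 2 := by positivity
  have hnorm (w : ℂ) : ‖((lam * Real.exp (K * lam) / 2 : ℝ) : ℂ) • H2 K (lam + w)‖ =
      lam * Real.exp (K * lam) / 2 * ‖H2 K (lam + w)‖ := by
    rw [norm_smul, Complex.norm_real, Real.norm_of_nonneg hcoef]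
  rw [← hnorm]
  refine norm_le_re_of_norm_le_re_imaginary_axis
    (f := ((lam * Real.exp (K * lam) / 2 : ℝ) : ℂ) • fun w => H2 K (lam + w))
    ((diffContOnCl_H2_add K hlam).const_smul _) (differentiable_H1 hK lam).diffContOnCl
    (fun w hw => (hnorm w).trans_le
      (mul_le_mul_of_nonneg_left (norm_H2_add_le hK hlam hw) hcoef))
    (fun w hw => norm_H1_le hK hlam hw) (fun y => le_of_eq ((hnorm _).trans ?_)) hz
  rw [norm_H2_add_mul_I, re_H1_mul_I hK hlam, Real.exp_neg]
  field_simp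
end
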